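/- Let γ₁, γ₂ ∈ SF⁺ and set q̄ = max(q̄(γ₁), q̄(γ₂)). For every bounded set K ⊂ ℝ and every integer k ≥ 0 there exists a constant C > 0, depending only on κ, q̄, K and k, such that sup_{t ∈ [0,q̄]} sup_{x ∈ K} |∂ₓᵏΦ_{γ₁}(t,x) − ∂ₓᵏΦ_{γ₂}(t,x)| ≤ C·∫_0^1 |γ₁(s) − γ₂(s)| ds. (Proposition 4.3 for step functions.) -/

import Mathlib

open MeasureTheory ProbabilityTheory

/-- The standard Gaussian measure on `ℝ`. -/
noncomputable def stdGauss : Measure ℝ := gaussianReal 0 1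

/-- The Gaussian tail function `𝒩(v) = P(Z ≥ v)`. -/
noncomputable def gaussTail (v : ℝ) : ℝ := (stdGauss (Set.Ici v)).toReal

/-- A functional order parameter in `SF⁺`: a non-decreasing step function
`γ = Σ_{i=0}^n m_i · 1_{[q_i, q_{i+1})}` with `0 = q_0 < q_1 < ⋯ < q_{n+1} = 1` and
`0 = m_0 ≤ m_1 ≤ ⋯ ≤ m_n = 1`. -/
structure StepFn where
  n : ℕ
  q : ℕ → ℝ
  m : ℕ → ℝ
  q_zero : q 0 = 0
  q_last : q (n + 1) = 1
  q_lt : ∀ i ≤ n, q i < q (i + 1)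
  m_zero : m 0 = 0
  m_last : m n = 1
  m_mono : ∀ i < n, m i ≤ m (i + 1)

namespace StepFn

/-- The right end `q̄(γ) = q_n` of the support of `γ`. -/
noncomputable def qbar (γ : StepFn) : ℝ := γ.q γ.n

open Classical in
/-- `γ` as a function: `γ(s) = m_i` for `s ∈ [q_i, q_{i+1})`, and `0` outside `[0,1)`. -/
noncomputable def toFun (γ : StepFn) (s : ℝ) : ℝ :=
  if s ∈ Set.Ico (0 : ℝ) 1 then γ.m (Nat.findGreatest (fun i => γ.q i ≤ s) γ.n) else 0

end StepFn

/-- One Cole–Hopf step: given a boundary value `g` at the right end of an interval,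
spread `s` and parameter `m`, produce the value at distance `s` from the right end. -/
noncomputable def coleHopf (m s : ℝ) (g : ℝ → ℝ) (x : ℝ) : ℝ :=
  if 0 < m then (1 / m) * Real.log (∫ z, Real.exp (m * g (x + Real.sqrt s * z)) ∂stdGauss)
  else ∫ z, g (x + Real.sqrt s * z) ∂stdGauss

namespace StepFn

/-- `PhiAux γ κ j` is the solution `Φ_γ` on the interval `[q_{n-j}, q_{n-j+1})`,
built recursively downward from the terminal condition on `[q_n, 1)`. -/
noncomputable def PhiAux (γ : StepFn) (κ : ℝ) : ℕ → ℝ → ℝ → ℝ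
  | 0 => fun t x => Real.log (gaussTail ((κ - x) / Real.sqrt (1 - t)))
  | j + 1 => fun t x =>
      coleHopf (γ.m (γ.n - (j + 1))) (γ.q (γ.n - j) - t) (γ.PhiAux κ j (γ.q (γ.n - j))) x

open Classical in
/-- The solution `Φ_γ(t,x)` of the Parisi PDE for the step function `γ`:
for `t ∈ [q_i, q_{i+1})` it is given by `PhiAux γ κ (n - i)`. -/
noncomputable def Phi (γ : StepFn) (κ : ℝ) (t x : ℝ) : ℝ :=
  γ.PhiAux κ (γ.n - Nat.findGreatest (fun i => γ.q i ≤ t) γ.n) t x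

end StepFn

section Helpers

open Filter Topology
open scoped ContDiff

/-! ### Polynomially bounded functions and Gaussian smoothing -/

instance : IsProbabilityMeasure stdGauss := by
  unfold stdGauss; infer_instance

/-- A function on `ℝ` bounded by a polynomial. -/
def PolyB (f : ℝ → ℝ) : Prop := ∃ C : ℝ, ∃ p : ℕ, 0 ≤ C ∧ ∀ x, |f x| ≤ C * (1 + x ^ 2) ^ p

lemma one_le_weight (p : ℕ) (x : ℝ) : 1 ≤ (1 + x ^ 2) ^ p :=
  one_le_pow₀ (by nlinarith [sq_nonneg x])

lemma weight_mono {p q : ℕ} (h : p ≤ q) (x : ℝ) : (1 + x ^ 2) ^ p ≤ (1 + x ^ 2) ^ q :=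
  pow_le_pow_right₀ (by nlinarith [sq_nonneg x]) h

lemma PolyB.const (c : ℝ) : PolyB fun _ => c := ⟨|c|, 0, abs_nonneg c, by simp⟩

lemma PolyB.id : PolyB fun x => x :=
  ⟨1, 1, zero_le_one, fun x => by rw [abs_le]; constructor <;> nlinarith [sq_nonneg (x - 1), sq_nonneg (x + 1)]⟩

lemma PolyB.add {f g : ℝ → ℝ} (hf : PolyB f) (hg : PolyB g) : PolyB fun x => f x + g x := by
  obtain ⟨C, p, hC, hf⟩ := hf
  obtain ⟨D, q, hD, hg⟩ := hg
  refine ⟨C + D, max p q, by positivity, fun x => ?_⟩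
  calc |f x + g x| ≤ |f x| + |g x| := abs_add_le _ _
    _ ≤ C * (1 + x ^ 2) ^ max p q + D * (1 + x ^ 2) ^ max p q := by
      gcongr
      · exact (hf x).trans (mul_le_mul_of_nonneg_left (weight_mono (le_max_left _ _) x) hC)
      · exact (hg x).trans (mul_le_mul_of_nonneg_left (weight_mono (le_max_right _ _) x) hD)
    _ = _ := by ring

lemma PolyB.mul {f g : ℝ → ℝ} (hf : PolyB f) (hg : PolyB g) : PolyB fun x => f x * g x := by
  obtain ⟨C, p, hC, hf⟩ := hf
  obtain ⟨D, q, hD, hg⟩ := hg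
  refine ⟨C * D, p + q, by positivity, fun x => ?_⟩
  rw [abs_mul, pow_add]
  calc |f x| * |g x| ≤ (C * (1 + x ^ 2) ^ p) * (D * (1 + x ^ 2) ^ q) := by
        gcongr
        · exact hf x
        · exact hg x
    _ = _ := by ring

lemma PolyB.of_le {f g : ℝ → ℝ} (hg : PolyB g) (h : ∀ x, |f x| ≤ |g x|) : PolyB f := by
  obtain ⟨C, p, hC, hg⟩ := hg
  exact ⟨C, p, hC, fun x => (h x).trans (hg x)⟩

lemma PolyB.neg {f : ℝ → ℝ} (hf : PolyB f) : PolyB fun x => -f x :=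
  hf.of_le fun x => by simp

lemma integrable_weight (p : ℕ) : Integrable (fun z : ℝ => (1 + z ^ 2) ^ p) stdGauss := by
  simp only [add_pow]
  refine integrable_finsetSum _ fun i _ => ?_
  have h : Integrable (fun z : ℝ => ‖_root_.id z‖ ^ (2 * (p - i))) stdGauss :=
    (memLp_id_gaussianReal' _ (ENNReal.natCast_ne_top _)).integrable_norm_pow'
  simp only [one_pow, one_mul, ← pow_mul]
  refine Integrable.mul_const ?_ _
  simpa [pow_mul] using h

lemma PolyB.integrable {f : ℝ → ℝ} (hf : PolyB f) (hc : Continuous f) :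
    Integrable f stdGauss := by
  obtain ⟨C, p, _, hf⟩ := hf
  exact ((integrable_weight p).const_mul C).mono' hc.aestronglyMeasurable
    (Eventually.of_forall hf)

lemma weight_shift_le {s S : ℝ} (hs : s ≤ S) (hS : 0 ≤ S) (p : ℕ) (x z : ℝ) :
    (1 + (x + √s * z) ^ 2) ^ p ≤ (2 * (1 + S)) ^ p * (1 + x ^ 2) ^ p * (1 + z ^ 2) ^ p := by
  rw [← mul_pow, ← mul_pow]
  have h1 : √s ^ 2 ≤ S := by
    rcases le_total 0 s with h | h
    · rw [Real.sq_sqrt h]; exact hs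
    · rw [Real.sqrt_eq_zero_of_nonpos h]; simpa using hS
  gcongr
  have h2 : (√s * z) ^ 2 ≤ S * z ^ 2 := by rw [mul_pow]; gcongr
  nlinarith [sq_nonneg (x - √s * z), mul_nonneg hS (sq_nonneg x), sq_nonneg x, sq_nonneg z,
    mul_nonneg (sq_nonneg x) (sq_nonneg z), mul_nonneg hS (mul_nonneg (sq_nonneg x) (sq_nonneg z))]

lemma PolyB.comp_shift {f : ℝ → ℝ} (hf : PolyB f) (s x : ℝ) : PolyB fun z => f (x + √s * z) := by
  obtain ⟨C, p, hC, hf⟩ := hf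
  refine ⟨C * ((2 * (1 + |s|)) ^ p * (1 + x ^ 2) ^ p), p, by positivity, fun z => ?_⟩
  refine (hf _).trans ?_
  rw [mul_assoc]
  gcongr
  exact weight_shift_le (le_abs_self s) (abs_nonneg s) p x z

/-- A function with polynomially bounded derivative is polynomially bounded. -/
lemma abs_le_weight_of_hasDerivAt {f f' : ℝ → ℝ} (hd : ∀ x, HasDerivAt f (f' x) x) {M C : ℝ} {p : ℕ}
    (h0 : |f 0| ≤ M) (hC : 0 ≤ C) (hb : ∀ x, |f' x| ≤ C * (1 + x ^ 2) ^ p) (x : ℝ) :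
    |f x| ≤ (M + C) * (1 + x ^ 2) ^ (p + 1) := by
  have hd' : ∀ z ∈ Set.uIcc 0 x, ‖f' z‖ ≤ C * (1 + x ^ 2) ^ p := by
    intro z hz
    refine (hb z).trans (mul_le_mul_of_nonneg_left (pow_le_pow_left₀ (by positivity) ?_ p) hC)
    have : |z| ≤ |x| := by simpa using Set.abs_sub_left_of_mem_uIcc hz
    have := sq_le_sq.2 this
    linarith
  have mv := (convex_uIcc (0 : ℝ) x).norm_image_sub_le_of_norm_hasDerivWithin_le
    (fun z _ => (hd z).hasDerivWithinAt) hd' (Set.left_mem_uIcc) (Set.right_mem_uIcc)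
  rw [sub_zero, Real.norm_eq_abs, Real.norm_eq_abs] at mv
  have h3 := abs_sub_abs_le_abs_sub (f x) (f 0)
  have h4 : |x| ≤ 1 + x ^ 2 := by
    rw [abs_le]; constructor <;> nlinarith [sq_nonneg (x - 1), sq_nonneg (x + 1)]
  have h5 := one_le_weight (p + 1) x
  have h6 := mul_le_mul_of_nonneg_left h4 (by positivity : 0 ≤ C * (1 + x ^ 2) ^ p)
  have h7 : C * (1 + x ^ 2) ^ p * (1 + x ^ 2) = C * (1 + x ^ 2) ^ (p + 1) := by ring
  have h8 := mul_le_mul_of_nonneg_left h5 ((abs_nonneg (f 0)).trans h0)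
  linarith

lemma hasDerivAt_gaussianPDFReal (z : ℝ) :
    HasDerivAt (gaussianPDFReal 0 1) (-z * gaussianPDFReal 0 1 z) z := by
  have : gaussianPDFReal 0 1 = fun x => (√(2 * Real.pi * 1))⁻¹ * Real.exp (-(x - 0) ^ 2 / (2 * 1)) := by
    ext x; simp [gaussianPDFReal]
  rw [this]
  have h := ((((((hasDerivAt_id z).sub_const 0).pow 2).neg).div_const (2 * 1)).exp).const_mul
    ((√(2 * Real.pi * 1))⁻¹)
  refine h.congr_deriv ?_
  simp
  ring

lemma PolyB.integrable_gaussianPDFReal_mul {f : ℝ → ℝ} (hfb : PolyB f) (hf : Continuous f) :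
    Integrable (fun z => gaussianPDFReal 0 1 z * f z) := by
  have h := hfb.integrable hf
  unfold stdGauss at h
  rw [gaussianReal_of_var_ne_zero _ one_ne_zero,
    integrable_withDensity_iff_integrable_smul₀' (by fun_prop)
      (Eventually.of_forall fun x => by simp [gaussianPDF])] at h
  refine h.congr (Eventually.of_forall fun z => ?_)
  simp [gaussianPDF, ENNReal.toReal_ofReal (gaussianPDFReal_nonneg 0 1 z)]

/-- The standard Gaussian integration by parts formula. -/
lemma integral_id_mul_stdGauss {k k' : ℝ → ℝ} (hk : ∀ z, HasDerivAt k (k' z) z)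
    (hk' : Continuous k') (hb : PolyB k) (hb' : PolyB k') :
    ∫ z, z * k z ∂stdGauss = ∫ z, k' z ∂stdGauss := by
  have hkc : Continuous k := continuous_iff_continuousAt.2 fun z => (hk z).continuousAt
  have h1 := integral_mul_deriv_eq_deriv_mul_of_integrable
    (u := k) (u' := k') (v := gaussianPDFReal 0 1) (v' := fun z => -z * gaussianPDFReal 0 1 z)
    (fun x _ => hk x) (fun x _ => hasDerivAt_gaussianPDFReal x)
    ((PolyB.integrable_gaussianPDFReal_mul (f := fun z => -(z * k z)) (PolyB.id.mul hb).neg (by fun_prop)).congr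
      (Eventually.of_forall fun z => by simp; ring))
    ((hb'.integrable_gaussianPDFReal_mul hk').congr (Eventually.of_forall fun z => by simp; ring))
    ((hb.integrable_gaussianPDFReal_mul hkc).congr (Eventually.of_forall fun z => by simp; ring))
  unfold stdGauss
  rw [integral_gaussianReal_eq_integral_smul one_ne_zero,
    integral_gaussianReal_eq_integral_smul one_ne_zero]
  have h2 : ∫ z, gaussianPDFReal 0 1 z • (z * k z) = -∫ z, k z * (-z * gaussianPDFReal 0 1 z) := by
    rw [← integral_neg]; congr 1; ext z; simp; ring
  rw [h2, h1, neg_neg]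
  congr 1; ext z; simp; ring

/-- Gaussian smoothing with variance `s`. -/
noncomputable def heat (F : ℝ → ℝ) (s x : ℝ) : ℝ := ∫ z, F (x + √s * z) ∂stdGauss

lemma integrable_shift {F : ℝ → ℝ} (hF : PolyB F) (hc : Continuous F) (s x : ℝ) :
    Integrable (fun z => F (x + √s * z)) stdGauss :=
  (hF.comp_shift s x).integrable (by fun_prop)

/-- Uniform polynomial domination near a point. -/
lemma PolyB.shift_bound {F : ℝ → ℝ} (hF : PolyB F) (S R : ℝ) (hS : 0 ≤ S) :
    ∃ C : ℝ, ∃ p : ℕ, 0 ≤ C ∧ ∀ s x z, s ≤ S → |x| ≤ R → |F (x + √s * z)| ≤ C * (1 + z ^ 2) ^ p := by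
  obtain ⟨C, p, hC, hF⟩ := hF
  refine ⟨C * ((2 * (1 + S)) ^ p * (1 + R ^ 2) ^ p), p, by positivity, fun s x z hs hx => ?_⟩
  refine (hF _).trans ?_
  rw [mul_assoc]
  gcongr
  refine (weight_shift_le hs hS p x z).trans ?_
  have : x ^ 2 ≤ R ^ 2 := sq_le_sq' (by linarith [neg_abs_le x]) (by linarith [le_abs_self x])
  gcongr

lemma continuous_heat {F : ℝ → ℝ} (hF : PolyB F) (hc : Continuous F) :
    Continuous fun q : ℝ × ℝ => heat F q.1 q.2 := by
  refine continuous_iff_continuousAt.2 fun q => ?_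
  obtain ⟨C, p, hC, hb⟩ := hF.shift_bound (|q.1| + 1) (|q.2| + 1) (by positivity)
  refine continuousAt_of_dominated (bound := fun z => C * (1 + z ^ 2) ^ p) ?_ ?_
    ((integrable_weight p).const_mul C) ?_
  · exact Eventually.of_forall fun q => Continuous.aestronglyMeasurable (by fun_prop)
  · have h1 : ∀ᶠ r : ℝ × ℝ in 𝓝 q, r.1 < |q.1| + 1 :=
      continuous_fst.continuousAt.eventually_lt_const (by linarith [le_abs_self q.1])
    have h2 : ∀ᶠ r : ℝ × ℝ in 𝓝 q, |r.2| < |q.2| + 1 :=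
      (continuous_abs.comp continuous_snd).continuousAt.eventually_lt_const (by simp)
    filter_upwards [h1, h2] with r hr1 hr2
    exact Eventually.of_forall fun z => hb _ _ z hr1.le hr2.le
  · exact Eventually.of_forall fun z => by fun_prop

lemma hasDerivAt_heat {F F' : ℝ → ℝ} (hd : ∀ x, HasDerivAt F (F' x) x) (hF : PolyB F)
    (hF' : PolyB F') (hc' : Continuous F') (s x : ℝ) :
    HasDerivAt (heat F s) (heat F' s x) x := by
  have hc : Continuous F := continuous_iff_continuousAt.2 fun z => (hd z).continuousAt
  obtain ⟨C, p, hC, hb⟩ := hF'.shift_bound |s| (|x| + 1) (by positivity)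
  refine (hasDerivAt_integral_of_dominated_loc_of_deriv_le (F := fun x z => F (x + √s * z))
    (F' := fun x z => F' (x + √s * z))
    (bound := fun z => C * (1 + z ^ 2) ^ p) (Metric.ball_mem_nhds x one_pos) ?_
    (integrable_shift hF hc s x) ?_ ?_ ((integrable_weight p).const_mul C) ?_).2
  · exact Eventually.of_forall fun q => Continuous.aestronglyMeasurable (by fun_prop)
  · exact Continuous.aestronglyMeasurable (by fun_prop)
  · refine Eventually.of_forall fun z y hy => hb _ _ z (le_abs_self s) ?_
    rw [Metric.mem_ball, Real.dist_eq] at hy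
    have := abs_sub_abs_le_abs_sub y x
    linarith
  · refine Eventually.of_forall fun z y _ => ?_
    simpa using (hd (y + √s * z)).comp_add_const y (√s * z)

lemma hasDerivAt_heat_var {F F' F'' : ℝ → ℝ} (hd : ∀ x, HasDerivAt F (F' x) x)
    (hd' : ∀ x, HasDerivAt F' (F'' x) x) (hF : PolyB F)
    (hF' : PolyB F') (hF'' : PolyB F'') (hc'' : Continuous F'') {s : ℝ} (hs : 0 < s) (x : ℝ) :
    HasDerivAt (fun s => heat F s x) (1 / 2 * heat F'' s x) s := by
  have hc : Continuous F := continuous_iff_continuousAt.2 fun z => (hd z).continuousAt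
  have hc' : Continuous F' := continuous_iff_continuousAt.2 fun z => (hd' z).continuousAt
  obtain ⟨C, p, hC, hb⟩ := (hF'.shift_bound (2 * s) (|x|) (by positivity))
  have hs2 : 0 < √(s / 2) := Real.sqrt_pos.2 (by positivity)
  have hdom : Integrable (fun z : ℝ => C * (1 + z ^ 2) ^ p * (|z| * (1 / (2 * √(s / 2))))) stdGauss := by
    refine PolyB.integrable ?_ (by fun_prop)
    refine PolyB.mul ⟨C, p, hC, fun x => by rw [abs_of_nonneg (by positivity)]⟩ (PolyB.mul ?_ (PolyB.const _))
    exact PolyB.id.of_le fun x => by simp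
  have hmain := (hasDerivAt_integral_of_dominated_loc_of_deriv_le (μ := stdGauss)
    (F := fun s z => F (x + √s * z)) (F' := fun s z => F' (x + √s * z) * (1 / (2 * √s) * z))
    (bound := fun z : ℝ => C * (1 + z ^ 2) ^ p * (|z| * (1 / (2 * √(s / 2))))) (x₀ := s)
    (s := Set.Ioo (s / 2) (2 * s))
    (Ioo_mem_nhds (by linarith) (by linarith)) ?_
    (integrable_shift hF hc s x) ?_ ?_ hdom ?_).2
  · have hst := integral_id_mul_stdGauss (k := fun z => F' (x + √s * z))
      (k' := fun z => F'' (x + √s * z) * √s) (fun z => ?_) (by fun_prop) (hF'.comp_shift s x)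
      ((hF''.comp_shift s x).mul (PolyB.const _))
    · have hs3 : 0 < √s := Real.sqrt_pos.2 hs
      have e1 : ∫ z, F' (x + √s * z) * (1 / (2 * √s) * z) ∂stdGauss
          = 1 / (2 * √s) * ∫ z, z * F' (x + √s * z) ∂stdGauss := by
        rw [← integral_const_mul]; congr 1; ext z; ring
      refine hmain.congr_deriv ?_
      rw [e1, hst, integral_mul_const, heat]
      field_simp
    · have := (hd' (x + √s * z)).comp z (((hasDerivAt_id z).const_mul (√s)).const_add x)
      exact this.congr_deriv (by simp)
  · exact Eventually.of_forall fun q => Continuous.aestronglyMeasurable (by fun_prop)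
  · exact Continuous.aestronglyMeasurable (by fun_prop)
  · refine Eventually.of_forall fun z y hy => ?_
    rw [Real.norm_eq_abs, abs_mul, abs_mul, mul_comm (|1 / (2 * √y)|)]
    have hy1 : √(s / 2) ≤ √y := Real.sqrt_le_sqrt hy.1.le
    gcongr
    · exact hb _ _ z hy.2.le le_rfl
    · rw [abs_of_nonneg (by positivity)]; gcongr
  · refine Eventually.of_forall fun z y hy => ?_
    have hy0 : y ≠ 0 := by have := hy.1; linarith
    have h1 : HasDerivAt (fun y => x + √y * z) (1 / (2 * √y) * z) y :=
      (((Real.hasDerivAt_sqrt hy0).mul_const z).const_add x)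
    exact (hd (x + √y * z)).comp y h1

/-! ### Tempered functions and the tilted semigroup -/

lemma hasTemperateGrowth_iff_polyB {f : ℝ → ℝ} :
    f.HasTemperateGrowth ↔ ContDiff ℝ ∞ f ∧ ∀ k, PolyB (iteratedDeriv k f) := by
  refine and_congr Iff.rfl (forall_congr' fun k => ⟨?_, ?_⟩)
  · rintro ⟨p, C, h⟩
    have hC : 0 ≤ C := by simpa using (norm_nonneg _).trans (h 0)
    refine ⟨C * 2 ^ p, p, by positivity, fun x => ?_⟩
    rw [← Real.norm_eq_abs, ← norm_iteratedFDeriv_eq_norm_iteratedDeriv]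
    refine (h x).trans ?_
    rw [mul_assoc, ← mul_pow]
    gcongr
    rw [Real.norm_eq_abs]
    nlinarith [sq_nonneg (|x| - 1), sq_abs x]
  · rintro ⟨C, p, hC, h⟩
    refine ⟨2 * p, C, fun x => ?_⟩
    rw [norm_iteratedFDeriv_eq_norm_iteratedDeriv, Real.norm_eq_abs, pow_mul]
    refine (h x).trans ?_
    gcongr
    rw [Real.norm_eq_abs]
    nlinarith [abs_nonneg x, sq_abs x]

namespace Function.HasTemperateGrowth

variable {f : ℝ → ℝ}

lemma polyB (hf : f.HasTemperateGrowth) : PolyB f := by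
  simpa using (hasTemperateGrowth_iff_polyB.1 hf).2 0

lemma differentiable_real (hf : f.HasTemperateGrowth) : Differentiable ℝ f :=
  hf.1.differentiable (by simp)

lemma hasDerivAt (hf : f.HasTemperateGrowth) (x : ℝ) : HasDerivAt f (deriv f x) x :=
  (hf.differentiable_real x).hasDerivAt

lemma real_deriv (hf : f.HasTemperateGrowth) : (deriv f).HasTemperateGrowth := by
  rw [hasTemperateGrowth_iff_polyB] at hf ⊢
  refine ⟨(contDiff_infty_iff_deriv.1 hf.1).2, fun k => ?_⟩
  rw [← iteratedDeriv_succ']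
  exact hf.2 (k + 1)

lemma continuous_real (hf : f.HasTemperateGrowth) : Continuous f := hf.1.continuous

end Function.HasTemperateGrowth

/-- A sequence of polynomially bounded successive derivatives. -/
lemma hasTemperateGrowth_of_seq {y : ℕ → ℝ → ℝ} (hd : ∀ k x, HasDerivAt (y k) (y (k + 1) x) x)
    (hb : ∀ k, PolyB (y k)) : (y 0).HasTemperateGrowth := by
  have hit : ∀ k, iteratedDeriv k (y 0) = y k := by
    intro k
    induction k with
    | zero => simp
    | succ k ih => rw [iteratedDeriv_succ, ih]; ext x; exact (hd k x).deriv
  refine hasTemperateGrowth_iff_polyB.2 ⟨?_, fun k => by rw [hit]; exact hb k⟩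
  refine contDiff_of_differentiable_iteratedDeriv fun k _ => ?_
  rw [hit]
  exact fun x => (hd k x).differentiableAt

/-- The derivative of `f` twisted by the weight `exp (m h)`. -/
noncomputable def twist (m : ℝ) (h f : ℝ → ℝ) (x : ℝ) : ℝ := deriv f x + m * f x * deriv h x

/-- The unnormalised tilted semigroup. -/
noncomputable def tiltHeat (m : ℝ) (h f : ℝ → ℝ) (s x : ℝ) : ℝ :=
  heat (fun y => f y * Real.exp (m * h y)) s x

/-- The successive twisted derivatives of `h'`. -/
noncomputable def jet (m : ℝ) (h : ℝ → ℝ) : ℕ → ℝ → ℝ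
  | 0 => deriv h
  | j + 1 => twist m h (jet m h j)

/-- Tilted averages of the twisted derivatives of `h'`. -/
noncomputable def tiltJet (m : ℝ) (h : ℝ → ℝ) (j : ℕ) (s x : ℝ) : ℝ :=
  tiltHeat m h (jet m h j) s x / tiltHeat m h (fun _ => 1) s x

section Tilt

variable {m : ℝ} {h : ℝ → ℝ}

lemma HasTemperateGrowth.twist (hh : h.HasTemperateGrowth) {f : ℝ → ℝ}
    (hf : f.HasTemperateGrowth) : (twist m h f).HasTemperateGrowth := by
  have h1 := ((Function.HasTemperateGrowth.const (E := ℝ) m).mul hf).mul hh.real_deriv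
  exact hf.real_deriv.add h1

lemma hasTemperateGrowth_jet (hh : h.HasTemperateGrowth) (j : ℕ) :
    (jet m h j).HasTemperateGrowth := by
  induction j with
  | zero => exact hh.real_deriv
  | succ j ih => exact HasTemperateGrowth.twist hh ih

lemma PolyB.mul_tilt (hm : 0 ≤ m) (h0 : ∀ x, h x ≤ 0) {f : ℝ → ℝ} (hf : PolyB f) :
    PolyB fun x => f x * Real.exp (m * h x) := by
  refine hf.of_le fun x => ?_
  rw [abs_mul, abs_of_pos (Real.exp_pos _)]
  refine mul_le_of_le_one_right (abs_nonneg _) ?_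
  rw [Real.exp_le_one_iff]
  exact mul_nonpos_of_nonneg_of_nonpos hm (h0 x)

lemma hasDerivAt_mul_tilt (hh : h.HasTemperateGrowth) {f : ℝ → ℝ} (hf : f.HasTemperateGrowth)
    (x : ℝ) : HasDerivAt (fun x => f x * Real.exp (m * h x)) (twist m h f x * Real.exp (m * h x)) x := by
  refine ((hf.hasDerivAt x).mul ((hh.hasDerivAt x).const_mul m).exp).congr_deriv ?_
  unfold twist
  ring

lemma continuous_mul_tilt (hh : h.HasTemperateGrowth) {f : ℝ → ℝ} (hf : f.HasTemperateGrowth) :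
    Continuous (fun x => f x * Real.exp (m * h x)) := by
  have := hh.continuous_real
  have := hf.continuous_real
  fun_prop

lemma continuous_tiltHeat (hm : 0 ≤ m) (hh : h.HasTemperateGrowth) (h0 : ∀ x, h x ≤ 0)
    {f : ℝ → ℝ} (hf : f.HasTemperateGrowth) :
    Continuous fun q : ℝ × ℝ => tiltHeat m h f q.1 q.2 :=
  continuous_heat (hf.polyB.mul_tilt hm h0) (continuous_mul_tilt hh hf)

lemma hasDerivAt_tiltHeat (hm : 0 ≤ m) (hh : h.HasTemperateGrowth) (h0 : ∀ x, h x ≤ 0)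
    {f : ℝ → ℝ} (hf : f.HasTemperateGrowth) (s x : ℝ) :
    HasDerivAt (tiltHeat m h f s) (tiltHeat m h (twist m h f) s x) x :=
  hasDerivAt_heat (hasDerivAt_mul_tilt hh hf) (hf.polyB.mul_tilt hm h0)
    ((HasTemperateGrowth.twist hh hf).polyB.mul_tilt hm h0)
    (continuous_mul_tilt hh (HasTemperateGrowth.twist hh hf)) s x

lemma hasDerivAt_tiltHeat_var (hm : 0 ≤ m) (hh : h.HasTemperateGrowth) (h0 : ∀ x, h x ≤ 0)
    {f : ℝ → ℝ} (hf : f.HasTemperateGrowth) {s : ℝ} (hs : 0 < s) (x : ℝ) :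
    HasDerivAt (fun s => tiltHeat m h f s x)
      (1 / 2 * tiltHeat m h (twist m h (twist m h f)) s x) s := by
  have h1 : (twist m h f).HasTemperateGrowth := HasTemperateGrowth.twist hh hf
  have h2 : (twist m h (twist m h f)).HasTemperateGrowth := HasTemperateGrowth.twist hh h1
  exact hasDerivAt_heat_var (hasDerivAt_mul_tilt hh hf) (hasDerivAt_mul_tilt hh h1)
    (hf.polyB.mul_tilt hm h0) (h1.polyB.mul_tilt hm h0) (h2.polyB.mul_tilt hm h0)
    (continuous_mul_tilt hh h2) hs x

lemma tiltHeat_const_mul (c : ℝ) (f : ℝ → ℝ) (s x : ℝ) :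
    tiltHeat m h (fun y => c * f y) s x = c * tiltHeat m h f s x := by
  unfold tiltHeat heat
  rw [← integral_const_mul]
  simp only [mul_assoc]

lemma twist_one : twist m h (fun _ => 1) = fun x => m * jet m h 0 x := by
  ext x; simp [twist, jet]

lemma twist_twist_one (hh : h.HasTemperateGrowth) :
    twist m h (twist m h (fun _ => 1)) = fun x => m * jet m h 1 x := by
  rw [twist_one]
  ext x
  have := ((hasTemperateGrowth_jet (m := m) hh 0).hasDerivAt x).const_mul m
  simp only [twist]
  rw [this.deriv]
  simp only [jet, twist]
  ring

lemma integrable_tilt (hm : 0 ≤ m) (hh : h.HasTemperateGrowth) (h0 : ∀ x, h x ≤ 0)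
    {f : ℝ → ℝ} (hf : PolyB f) (hc : Continuous f) (s x : ℝ) :
    Integrable (fun z => f z * Real.exp (m * h (x + √s * z))) stdGauss := by
  have h1 := PolyB.mul_tilt hm h0 (PolyB.const 1)
  have h2 := hf.mul (h1.comp_shift s x)
  simp only [one_mul] at h2
  have := hh.continuous_real
  exact h2.integrable (by fun_prop)

lemma tiltHeat_one_pos (hm : 0 ≤ m) (hh : h.HasTemperateGrowth) (h0 : ∀ x, h x ≤ 0) (s x : ℝ) :
    0 < tiltHeat m h (fun _ => 1) s x := by
  have h1 := integrable_tilt hm hh h0 (PolyB.const 1) continuous_const s x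
  simp only [one_mul] at h1
  simpa [tiltHeat, heat] using integral_exp_pos h1

lemma hasDerivAt_tiltJet (hm : 0 ≤ m) (hh : h.HasTemperateGrowth) (h0 : ∀ x, h x ≤ 0)
    (j : ℕ) (s x : ℝ) :
    HasDerivAt (tiltJet m h j s)
      (tiltJet m h (j + 1) s x - m * tiltJet m h j s x * tiltJet m h 0 s x) x := by
  have hpos := tiltHeat_one_pos hm hh h0 s x
  refine ((hasDerivAt_tiltHeat hm hh h0 (hasTemperateGrowth_jet hh j) s x).div
    (hasDerivAt_tiltHeat hm hh h0 (Function.HasTemperateGrowth.const 1) s x) hpos.ne').congr_deriv ?_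
  rw [twist_one, tiltHeat_const_mul]
  simp only [tiltJet, jet]
  field_simp

lemma hasDerivAt_tiltJet_var (hm : 0 ≤ m) (hh : h.HasTemperateGrowth) (h0 : ∀ x, h x ≤ 0)
    (j : ℕ) {s : ℝ} (hs : 0 < s) (x : ℝ) :
    HasDerivAt (fun s => tiltJet m h j s x)
      (1 / 2 * (tiltJet m h (j + 2) s x - m * tiltJet m h j s x * tiltJet m h 1 s x)) s := by
  have hpos := tiltHeat_one_pos hm hh h0 s x
  refine ((hasDerivAt_tiltHeat_var hm hh h0 (hasTemperateGrowth_jet hh j) hs x).div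
    (hasDerivAt_tiltHeat_var hm hh h0 (Function.HasTemperateGrowth.const 1) hs x) hpos.ne').congr_deriv ?_
  rw [twist_twist_one hh, tiltHeat_const_mul]
  simp only [tiltJet, jet]
  field_simp

lemma continuous_tiltJet (hm : 0 ≤ m) (hh : h.HasTemperateGrowth) (h0 : ∀ x, h x ≤ 0) (j : ℕ) :
    Continuous fun q : ℝ × ℝ => tiltJet m h j q.1 q.2 :=
  (continuous_tiltHeat hm hh h0 (hasTemperateGrowth_jet hh j)).div
    (continuous_tiltHeat hm hh h0 (Function.HasTemperateGrowth.const 1))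
    fun q => (tiltHeat_one_pos hm hh h0 q.1 q.2).ne'

lemma coleHopf_hasDerivAt (hm : 0 ≤ m) (hh : h.HasTemperateGrowth) (h0 : ∀ x, h x ≤ 0) (s x : ℝ) :
    HasDerivAt (coleHopf m s h) (tiltJet m h 0 s x) x := by
  rcases hm.eq_or_lt with rfl | hpos
  · refine ((hasDerivAt_tiltHeat le_rfl hh h0 hh s x).congr_deriv ?_).congr_of_eventuallyEq
      (Eventually.of_forall fun y => ?_)
    · simp [tiltJet, tiltHeat, heat, jet, twist]
    · simp [coleHopf, tiltHeat, heat]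
  · have h1 := tiltHeat_one_pos hm hh h0 s x
    refine (((hasDerivAt_tiltHeat hm hh h0 (Function.HasTemperateGrowth.const 1) s x).log
      h1.ne').const_mul (1 / m)).congr_deriv ?_ |>.congr_of_eventuallyEq
      (Eventually.of_forall fun y => ?_)
    · rw [twist_one, tiltHeat_const_mul, tiltJet]
      field_simp
    · simp [coleHopf, tiltHeat, heat, hpos]

lemma coleHopf_hasDerivAt_var (hm : 0 ≤ m) (hh : h.HasTemperateGrowth) (h0 : ∀ x, h x ≤ 0)
    {s : ℝ} (hs : 0 < s) (x : ℝ) :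
    HasDerivAt (fun s => coleHopf m s h x) (1 / 2 * tiltJet m h 1 s x) s := by
  rcases hm.eq_or_lt with rfl | hpos
  · refine ((hasDerivAt_tiltHeat_var le_rfl hh h0 hh hs x).congr_deriv ?_).congr_of_eventuallyEq
      (Eventually.of_forall fun y => ?_)
    · have e : twist 0 h h = deriv h := by ext y; simp [twist]
      rw [e]
      simp [tiltJet, tiltHeat, heat, jet]
    · simp [coleHopf, tiltHeat, heat]
  · have h1 := tiltHeat_one_pos hm hh h0 s x
    refine (((hasDerivAt_tiltHeat_var hm hh h0 (Function.HasTemperateGrowth.const 1) hs x).log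
      h1.ne').const_mul (1 / m)).congr_deriv ?_ |>.congr_of_eventuallyEq
      (Eventually.of_forall fun y => ?_)
    · rw [twist_twist_one hh, tiltHeat_const_mul, tiltJet]
      field_simp
    · simp [coleHopf, tiltHeat, heat, hpos]

lemma continuous_coleHopf (hm : 0 ≤ m) (hh : h.HasTemperateGrowth) (h0 : ∀ x, h x ≤ 0) :
    Continuous fun q : ℝ × ℝ => coleHopf m q.1 h q.2 := by
  rcases hm.eq_or_lt with rfl | hpos
  · refine (continuous_tiltHeat le_rfl hh h0 hh).congr fun q => ?_
    simp [coleHopf, tiltHeat, heat]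
  · refine (continuous_const.mul ((continuous_tiltHeat hm hh h0
      (Function.HasTemperateGrowth.const 1)).log fun q => (tiltHeat_one_pos hm hh h0 q.1 q.2).ne')).congr
      (f := fun q : ℝ × ℝ => (1 / m) * Real.log (tiltHeat m h (fun _ => 1) q.1 q.2)) fun q => ?_
    simp [coleHopf, tiltHeat, heat, hpos]

lemma coleHopf_zero_var (hm : 0 ≤ m) (x : ℝ) : coleHopf m 0 h x = h x := by
  rcases hm.eq_or_lt with rfl | hpos
  · simp [coleHopf]
  · simp [coleHopf, hpos, hpos.ne']

lemma coleHopf_nonpos (hm : 0 ≤ m) (hh : h.HasTemperateGrowth) (h0 : ∀ x, h x ≤ 0) (s x : ℝ) :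
    coleHopf m s h x ≤ 0 := by
  rcases hm.eq_or_lt with rfl | hpos
  · simp only [coleHopf, lt_irrefl, if_false]
    exact integral_nonpos fun z => h0 _
  · simp only [coleHopf, hpos, if_true]
    refine mul_nonpos_of_nonneg_of_nonpos (by positivity) (Real.log_nonpos
      (integral_nonneg fun z => (Real.exp_pos _).le) ?_)
    have h1 := integrable_tilt hm hh h0 (PolyB.const 1) continuous_const s x
    simp only [one_mul] at h1
    refine (integral_mono h1 (integrable_const 1) fun z => ?_).trans (by simp)
    simpa using mul_nonpos_of_nonneg_of_nonpos hm (h0 _)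

end Tilt

/-! ### Moments of the tilted measure and concavity -/

section Moments

variable {m : ℝ} {h : ℝ → ℝ}

/-- Gaussian integration by parts for the tilted semigroup. -/
lemma integral_id_mul_tilt (hm : 0 ≤ m) (hh : h.HasTemperateGrowth) (h0 : ∀ x, h x ≤ 0)
    {f k k' : ℝ → ℝ} (hf : f.HasTemperateGrowth) (hk : ∀ z, HasDerivAt k (k' z) z)
    (hk' : Continuous k') (hb : PolyB k) (hb' : PolyB k') (s x : ℝ) :
    ∫ z, z * (k z * (f (x + √s * z) * Real.exp (m * h (x + √s * z)))) ∂stdGauss =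
      ∫ z, k' z * (f (x + √s * z) * Real.exp (m * h (x + √s * z))) ∂stdGauss +
      √s * ∫ z, k z * (twist m h f (x + √s * z) * Real.exp (m * h (x + √s * z))) ∂stdGauss := by
  have hkc : Continuous k := continuous_iff_continuousAt.2 fun z => (hk z).continuousAt
  have ht : (twist m h f).HasTemperateGrowth := HasTemperateGrowth.twist hh hf
  have c0 := hh.continuous_real
  have c1 := hf.continuous_real
  have c2 := ht.continuous_real
  have b1 := hb'.mul ((hf.polyB.mul_tilt hm h0).comp_shift s x)
  have b2 := hb.mul ((ht.polyB.mul_tilt hm h0).comp_shift s x)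
  have b3 := (PolyB.const (√s)).mul b2
  rw [integral_id_mul_stdGauss (k' := fun z =>
    k' z * (f (x + √s * z) * Real.exp (m * h (x + √s * z))) +
      √s * (k z * (twist m h f (x + √s * z) * Real.exp (m * h (x + √s * z))))) ?_ (by fun_prop)
      (hb.mul ((hf.polyB.mul_tilt hm h0).comp_shift s x)) (b1.add b3),
    integral_add (b1.integrable (by fun_prop)) (b3.integrable (by fun_prop)), integral_const_mul]
  intro z
  have h1 : HasDerivAt (fun z => x + √s * z) (√s) z := by
    simpa using ((hasDerivAt_id z).const_mul (√s)).const_add x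
  refine ((hk z).mul ((hasDerivAt_mul_tilt (m := m) hh hf (x + √s * z)).comp z h1)).congr_deriv ?_
  simp only [Function.comp]
  ring

lemma integral_id_mul_tilt' (hm : 0 ≤ m) (hh : h.HasTemperateGrowth) (h0 : ∀ x, h x ≤ 0)
    {f : ℝ → ℝ} (hf : f.HasTemperateGrowth) (s x : ℝ) :
    ∫ z, z * (f (x + √s * z) * Real.exp (m * h (x + √s * z))) ∂stdGauss =
      √s * tiltHeat m h (twist m h f) s x := by
  have := integral_id_mul_tilt hm hh h0 hf (k := fun _ => 1) (k' := fun _ => 0)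
    (fun z => hasDerivAt_const z 1) continuous_const (PolyB.const 1) (PolyB.const 0) s x
  simpa [tiltHeat, heat] using this

/-- Moments of the tilted measure satisfy a one-step recursion. -/
lemma tilt_moment_succ_le (hm : 0 ≤ m) (hh : h.HasTemperateGrowth) (h0 : ∀ x, h x ≤ 0)
    (ha : Antitone (deriv h)) (p : ℕ) (s x : ℝ) :
    ∫ z, (1 + z ^ 2) ^ (p + 1) * Real.exp (m * h (x + √s * z)) ∂stdGauss ≤
      (4 * (p + 1) + (m * √s * deriv h x) ^ 2) *
        ∫ z, (1 + z ^ 2) ^ p * Real.exp (m * h (x + √s * z)) ∂stdGauss := by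
  set e : ℝ → ℝ := fun z => Real.exp (m * h (x + √s * z)) with he
  have hepos : ∀ z, 0 < e z := fun z => Real.exp_pos _
  have c0 := hh.continuous_real
  have c1 := hh.real_deriv.continuous_real
  have hw : ∀ q : ℕ, PolyB fun z : ℝ => (1 + z ^ 2) ^ q := fun q =>
    ⟨1, q, zero_le_one, fun z => by rw [abs_of_nonneg (by positivity), one_mul]⟩
  have I : ∀ {f : ℝ → ℝ}, PolyB f → Continuous f → Integrable (fun z => f z * e z) stdGauss :=
    fun hf hc => integrable_tilt hm hh h0 hf hc s x
  have bk' : PolyB fun z : ℝ => (1 + z ^ 2) ^ p + z * (p * (1 + z ^ 2) ^ (p - 1) * (2 * z)) :=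
    (hw p).add (PolyB.id.mul (((PolyB.const _).mul (hw _)).mul ((PolyB.const 2).mul PolyB.id)))
  have st := integral_id_mul_tilt hm hh h0 (f := fun _ => 1) (Function.HasTemperateGrowth.const 1)
    (k := fun z => z * (1 + z ^ 2) ^ p)
    (k' := fun z => (1 + z ^ 2) ^ p + z * (p * (1 + z ^ 2) ^ (p - 1) * (2 * z)))
    (fun z => ?_) (by fun_prop) (PolyB.id.mul (hw p)) bk' s x
  swap
  · refine ((hasDerivAt_id z).mul (((hasDerivAt_id z).pow 2).const_add 1 |>.pow p)).congr_deriv ?_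
    simp
  rw [twist_one] at st
  simp only [one_mul, jet] at st
  set N0 := ∫ z, (1 + z ^ 2) ^ p * e z ∂stdGauss
  set N1 := ∫ z, (1 + z ^ 2) ^ (p + 1) * e z ∂stdGauss
  set a := m * √s * deriv h x
  have e1 : N1 = N0 + ∫ z, z * (z * (1 + z ^ 2) ^ p * e z) ∂stdGauss := by
    have hi : Integrable (fun z => z * (z * (1 + z ^ 2) ^ p * e z)) stdGauss :=
      (I (PolyB.id.mul (PolyB.id.mul (hw p))) (by fun_prop)).congr
        (Eventually.of_forall fun z => by ring)
    rw [← integral_add (I (hw p) (by fun_prop)) hi]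
    refine integral_congr_ae (Eventually.of_forall fun z => ?_)
    simp only
    ring
  have e2 : ∫ z, ((1 + z ^ 2) ^ p + z * (p * (1 + z ^ 2) ^ (p - 1) * (2 * z))) * e z ∂stdGauss
      ≤ (2 * p + 1) * N0 := by
    rw [← integral_const_mul]
    refine integral_mono (I bk' (by fun_prop)) ((I (hw p) (by fun_prop)).const_mul _) fun z => ?_
    dsimp only
    rw [← mul_assoc (2 * (p : ℝ) + 1)]
    refine mul_le_mul_of_nonneg_right ?_ (hepos z).le
    rcases p with _ | p
    · simp
    · have h1 : 0 ≤ (1 + z ^ 2) ^ p := by positivity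
      simp only [Nat.add_sub_cancel, pow_succ (1 + z ^ 2)]
      push_cast
      nlinarith [mul_nonneg (Nat.cast_nonneg (α := ℝ) p) h1]
  have e3 : √s * ∫ z, z * (1 + z ^ 2) ^ p * (m * deriv h (x + √s * z) * e z) ∂stdGauss
      ≤ 1 / 2 * N1 + a ^ 2 / 2 * N0 := by
    have b4 : PolyB fun z => √s * (z * (1 + z ^ 2) ^ p * (m * deriv h (x + √s * z))) :=
      (PolyB.const _).mul ((PolyB.id.mul (hw p)).mul ((PolyB.const _).mul
        (hh.real_deriv.polyB.comp_shift s x)))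
    rw [← integral_const_mul, ← integral_const_mul, ← integral_const_mul,
      ← integral_add ((I (hw _) (by fun_prop)).const_mul _) ((I (hw _) (by fun_prop)).const_mul _)]
    refine integral_mono ((I b4 (by fun_prop)).congr (Eventually.of_forall fun z => by ring))
      (((I (hw _) (by fun_prop)).const_mul _).add ((I (hw _) (by fun_prop)).const_mul _)) fun z => ?_
    have h1 : z * (√s * (m * deriv h (x + √s * z))) ≤ z * a := by
      have hsm : 0 ≤ √s * m := by positivity
      have hz : z * deriv h (x + √s * z) ≤ z * deriv h x := by
        rcases le_total 0 z with hz | hz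
        · exact mul_le_mul_of_nonneg_left (ha (by nlinarith [Real.sqrt_nonneg s])) hz
        · exact mul_le_mul_of_nonpos_left (ha (by nlinarith [Real.sqrt_nonneg s])) hz
      simp only [a]
      nlinarith [mul_le_mul_of_nonneg_left hz hsm]
    have h2 : z * a ≤ 1 / 2 * (1 + z ^ 2) + a ^ 2 / 2 := by nlinarith [sq_nonneg (z - a)]
    have h3 : 0 ≤ (1 + z ^ 2) ^ p * e z := mul_nonneg (by positivity) (hepos z).le
    have h4 := mul_le_mul_of_nonneg_right (h1.trans h2) h3
    simp only [pow_succ (1 + z ^ 2)] at h4 ⊢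
    nlinarith [h4]
  have hN0 : 0 ≤ N0 := integral_nonneg fun z => mul_nonneg (by positivity) (hepos z).le
  have : N1 ≤ N0 + ((2 * p + 1) * N0 + (1 / 2 * N1 + a ^ 2 / 2 * N0)) := by
    rw [e1] at *
    linarith
  nlinarith

lemma tilt_moment_le (hm : 0 ≤ m) (hh : h.HasTemperateGrowth) (h0 : ∀ x, h x ≤ 0)
    (ha : Antitone (deriv h)) {S : ℝ} (hS : 0 ≤ S) (p : ℕ) :
    ∃ C : ℝ, ∃ q : ℕ, 0 ≤ C ∧ ∀ s ≤ S, ∀ x,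
      ∫ z, (1 + z ^ 2) ^ p * Real.exp (m * h (x + √s * z)) ∂stdGauss ≤
        C * (1 + x ^ 2) ^ q * tiltHeat m h (fun _ => 1) s x := by
  induction p with
  | zero => exact ⟨1, 0, zero_le_one, fun s _ x => by simp [tiltHeat, heat]⟩
  | succ p ih =>
    obtain ⟨C, q, hC, ih⟩ := ih
    obtain ⟨D, r, hD, hd⟩ := hh.real_deriv.polyB
    refine ⟨(4 * (p + 1) + m ^ 2 * S * D ^ 2) * C, 2 * r + q, by positivity, fun s hs x => ?_⟩
    refine (tilt_moment_succ_le hm hh h0 ha p s x).trans ?_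
    have hs' : √s ^ 2 ≤ S := by
      rcases le_total 0 s with h | h
      · rw [Real.sq_sqrt h]; exact hs
      · rw [Real.sqrt_eq_zero_of_nonpos h]; simpa using hS
    have h1 : (m * √s * deriv h x) ^ 2 ≤ m ^ 2 * S * D ^ 2 * (1 + x ^ 2) ^ (2 * r) := by
      have h2 : deriv h x ^ 2 ≤ D ^ 2 * (1 + x ^ 2) ^ (2 * r) := by
        rw [pow_mul', ← mul_pow, ← sq_abs]
        exact pow_le_pow_left₀ (abs_nonneg _) (hd x) 2
      calc (m * √s * deriv h x) ^ 2 = m ^ 2 * (√s ^ 2) * deriv h x ^ 2 := by ring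
        _ ≤ m ^ 2 * S * (D ^ 2 * (1 + x ^ 2) ^ (2 * r)) := by gcongr
        _ = _ := by ring
    have h3 : (4 * (p + 1) + (m * √s * deriv h x) ^ 2) ≤
        (4 * (p + 1) + m ^ 2 * S * D ^ 2) * (1 + x ^ 2) ^ (2 * r) := by
      have := one_le_weight (2 * r) x
      nlinarith [(by positivity : (0 : ℝ) ≤ 4 * (p + 1))]
    calc _ ≤ ((4 * (p + 1) + m ^ 2 * S * D ^ 2) * (1 + x ^ 2) ^ (2 * r)) *
          (C * (1 + x ^ 2) ^ q * tiltHeat m h (fun _ => 1) s x) := by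
          refine mul_le_mul h3 (ih s hs x) (integral_nonneg fun z => ?_) (by positivity)
          positivity
      _ = _ := by ring

lemma abs_tiltHeat_le (hm : 0 ≤ m) (hh : h.HasTemperateGrowth) (h0 : ∀ x, h x ≤ 0)
    (ha : Antitone (deriv h)) {S : ℝ} (hS : 0 ≤ S) {f : ℝ → ℝ} (hf : PolyB f) :
    ∃ C : ℝ, ∃ q : ℕ, 0 ≤ C ∧ ∀ s ≤ S, ∀ x,
      |tiltHeat m h f s x| ≤ C * (1 + x ^ 2) ^ q * tiltHeat m h (fun _ => 1) s x := by
  obtain ⟨D, p, hD, hf⟩ := hf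
  obtain ⟨C, q, hC, hM⟩ := tilt_moment_le hm hh h0 ha hS p
  refine ⟨D * (2 * (1 + S)) ^ p * C, p + q, by positivity, fun s hs x => ?_⟩
  have hw : PolyB fun z : ℝ => (1 + z ^ 2) ^ p :=
    ⟨1, p, zero_le_one, fun z => by rw [abs_of_nonneg (by positivity), one_mul]⟩
  have hI := integrable_tilt hm hh h0 hw (by fun_prop) s x
  calc |tiltHeat m h f s x| ≤ ∫ z, D * ((2 * (1 + S)) ^ p * (1 + x ^ 2) ^ p) *
        ((1 + z ^ 2) ^ p * Real.exp (m * h (x + √s * z))) ∂stdGauss := by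
        rw [← Real.norm_eq_abs, tiltHeat, heat]
        refine norm_integral_le_of_norm_le (hI.const_mul _) (Eventually.of_forall fun z => ?_)
        rw [Real.norm_eq_abs, abs_mul, abs_of_pos (Real.exp_pos _), ← mul_assoc]
        refine mul_le_mul_of_nonneg_right ((hf _).trans ?_) (Real.exp_pos _).le
        rw [mul_assoc]
        exact mul_le_mul_of_nonneg_left (weight_shift_le hs hS p x z) hD
    _ ≤ D * ((2 * (1 + S)) ^ p * (1 + x ^ 2) ^ p) *
        (C * (1 + x ^ 2) ^ q * tiltHeat m h (fun _ => 1) s x) := by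
        rw [integral_const_mul]
        exact mul_le_mul_of_nonneg_left (hM s hs x) (by positivity)
    _ = _ := by ring

lemma abs_tiltJet_le (hm : 0 ≤ m) (hh : h.HasTemperateGrowth) (h0 : ∀ x, h x ≤ 0)
    (ha : Antitone (deriv h)) {S : ℝ} (hS : 0 ≤ S) (j : ℕ) :
    ∃ C : ℝ, ∃ q : ℕ, 0 ≤ C ∧ ∀ s ≤ S, ∀ x, |tiltJet m h j s x| ≤ C * (1 + x ^ 2) ^ q := by
  obtain ⟨C, q, hC, hb⟩ := abs_tiltHeat_le hm hh h0 ha hS (hasTemperateGrowth_jet (m := m) hh j).polyB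
  refine ⟨C, q, hC, fun s hs x => ?_⟩
  have hpos := tiltHeat_one_pos hm hh h0 s x
  rw [tiltJet, abs_div, abs_of_pos hpos, div_le_iff₀ hpos]
  exact hb s hs x

/-- The smoothing step preserves concavity. -/
lemma tiltJet_one_sub_nonpos (hm : 0 ≤ m) (hh : h.HasTemperateGrowth) (h0 : ∀ x, h x ≤ 0)
    (ha : Antitone (deriv h)) {s : ℝ} (hs : 0 < s) (x : ℝ) :
    tiltJet m h 1 s x - m * tiltJet m h 0 s x * tiltJet m h 0 s x ≤ 0 := by
  have hpos := tiltHeat_one_pos hm hh h0 s x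
  have hs' : 0 < √s := Real.sqrt_pos.2 hs
  have c0 := hh.continuous_real
  have c1 := hh.real_deriv.continuous_real
  have s1 := integral_id_mul_tilt' hm hh h0 hh.real_deriv s x
  have s2 := integral_id_mul_tilt' hm hh h0 (f := fun _ => 1) (Function.HasTemperateGrowth.const 1) s x
  rw [twist_one, tiltHeat_const_mul] at s2
  set H1 := tiltHeat m h (fun _ => 1) s x with hH1
  set A := tiltHeat m h (jet m h 0) s x with hA
  set B := tiltHeat m h (jet m h 1) s x with hB
  change _ = √s * B at s1
  set e : ℝ → ℝ := fun z => Real.exp (m * h (x + √s * z)) with he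
  simp only [one_mul] at s2
  have I : ∀ {f : ℝ → ℝ}, PolyB f → Continuous f → Integrable (fun z => f z * e z) stdGauss :=
    fun hf hc => integrable_tilt hm hh h0 hf hc s x
  set z0 := √s * (m * A) / H1 with hz0
  set c := deriv h (x + √s * z0)
  have bh := hh.real_deriv.polyB.comp_shift s x
  have key : ∫ z, (z * (deriv h (x + √s * z) * e z) - z0 * (deriv h (x + √s * z) * e z)
      - (c * (z * e z) - c * z0 * e z)) ∂stdGauss ≤ 0 := by
    refine integral_nonpos fun z => ?_
    have h1 : (z - z0) * (deriv h (x + √s * z) - c) ≤ 0 := by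
      rcases le_total z z0 with hz | hz
      · refine mul_nonpos_of_nonpos_of_nonneg (by linarith) ?_
        have : c ≤ deriv h (x + √s * z) := ha (by gcongr)
        linarith
      · refine mul_nonpos_of_nonneg_of_nonpos (by linarith) ?_
        have : deriv h (x + √s * z) ≤ c := ha (by gcongr)
        linarith
    have h2 := mul_nonpos_of_nonpos_of_nonneg h1 (Real.exp_pos (m * h (x + √s * z))).le
    simp only [Pi.zero_apply]
    refine le_trans (le_of_eq ?_) h2
    ring
  have i1 : Integrable (fun z => z * (deriv h (x + √s * z) * e z)) stdGauss :=
    (I (PolyB.id.mul bh) (by fun_prop)).congr (Eventually.of_forall fun z => by ring)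
  have i2 := I bh (by fun_prop)
  have i3 := I PolyB.id (by fun_prop)
  have i4 : Integrable e stdGauss := by simpa using I (PolyB.const 1) (by fun_prop)
  have a1 : ∫ z, deriv h (x + √s * z) * e z ∂stdGauss = A := rfl
  have a2 : ∫ z, e z ∂stdGauss = H1 := by simp [hH1, tiltHeat, heat, he]
  have j2 : Integrable (fun z => z0 * (deriv h (x + √s * z) * e z)) stdGauss := i2.const_mul _
  have j3 : Integrable (fun z => c * (z * e z)) stdGauss := i3.const_mul _
  have j4 : Integrable (fun z => c * z0 * e z) stdGauss := i4.const_mul _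
  have d1 : Integrable (fun z => z * (deriv h (x + √s * z) * e z) -
    z0 * (deriv h (x + √s * z) * e z)) stdGauss := i1.sub j2
  have d2 : Integrable (fun z => c * (z * e z) - c * z0 * e z) stdGauss := j3.sub j4
  rw [integral_sub d1 d2, integral_sub i1 j2, integral_sub j3 j4,
    integral_const_mul, integral_const_mul, integral_const_mul, s1, s2, a1, a2, hz0] at key
  have k2 : B * H1 - m * A * A ≤ 0 := by
    have e1 : √s * B - √s * (m * A) / H1 * A - (c * (√s * (m * A)) - c * (√s * (m * A) / H1) * H1)
        = √s / H1 * (B * H1 - m * A * A) := by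
      field_simp
      ring
    rw [e1] at key
    by_contra hcon
    push Not at hcon
    have : 0 < √s / H1 * (B * H1 - m * A * A) := by positivity
    linarith
  have e2 : B / H1 - m * (A / H1) * (A / H1) = (B * H1 - m * A * A) / H1 ^ 2 := by
    field_simp
  change B / H1 - m * (A / H1) * (A / H1) ≤ 0
  rw [e2]
  exact div_nonpos_of_nonpos_of_nonneg k2 (by positivity)

/-- The smoothing step preserves lower bounds on the second derivative. -/
lemma le_tiltJet_one_sub (hm : 0 ≤ m) (hh : h.HasTemperateGrowth) (h0 : ∀ x, h x ≤ 0)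
    {C : ℝ} (hC : ∀ x, -C ≤ deriv (deriv h) x) (s x : ℝ) :
    -C ≤ tiltJet m h 1 s x - m * tiltJet m h 0 s x * tiltJet m h 0 s x := by
  have hpos := tiltHeat_one_pos hm hh h0 s x
  have c0 := hh.continuous_real
  have c1 := hh.real_deriv.continuous_real
  have c2 := hh.real_deriv.real_deriv.continuous_real
  set H1 := tiltHeat m h (fun _ => 1) s x with hH1
  set A := tiltHeat m h (jet m h 0) s x with hA
  set B := tiltHeat m h (jet m h 1) s x with hB
  set e : ℝ → ℝ := fun z => Real.exp (m * h (x + √s * z)) with he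
  have I : ∀ {f : ℝ → ℝ}, PolyB f → Continuous f → Integrable (fun z => f z * e z) stdGauss :=
    fun hf hc => integrable_tilt hm hh h0 hf hc s x
  have b1 := hh.real_deriv.polyB.comp_shift s x
  have b2 := hh.real_deriv.real_deriv.polyB.comp_shift s x
  have i0 := I (b1.mul b1) (by fun_prop)
  have i1 := I b1 (by fun_prop)
  have i2 := I b2 (by fun_prop)
  have i4 : Integrable e stdGauss := by simpa using I (PolyB.const 1) (by fun_prop)
  have a1 : ∫ z, deriv h (x + √s * z) * e z ∂stdGauss = A := rfl
  have a2 : ∫ z, e z ∂stdGauss = H1 := by simp [hH1, tiltHeat, heat, he]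
  set Q := ∫ z, deriv h (x + √s * z) * deriv h (x + √s * z) * e z ∂stdGauss with hQ
  set R := ∫ z, deriv (deriv h) (x + √s * z) * e z ∂stdGauss with hR
  have eB : B = R + m * Q := by
    rw [hQ, hR, ← integral_const_mul, ← integral_add i2 (i0.const_mul m), hB]
    simp only [tiltHeat, heat, jet, twist]
    congr 1; ext z; simp only [he]; ring
  have hR' : -C * H1 ≤ R := by
    rw [← a2, ← integral_const_mul]
    exact integral_mono (i4.const_mul _) i2 fun z =>
      mul_le_mul_of_nonneg_right (hC _) (Real.exp_pos _).le
  have hQ' : A * A ≤ Q * H1 := by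
    have key : 0 ≤ ∫ z, (deriv h (x + √s * z) * deriv h (x + √s * z) * e z
        - (2 * (A / H1) * (deriv h (x + √s * z) * e z) - (A / H1) ^ 2 * e z)) ∂stdGauss := by
      refine integral_nonneg fun z => ?_
      have : 0 ≤ (deriv h (x + √s * z) - A / H1) ^ 2 * e z :=
        mul_nonneg (sq_nonneg _) (Real.exp_pos _).le
      simp only [Pi.zero_apply]
      refine this.trans (le_of_eq ?_)
      ring
    have j1 : Integrable (fun z => 2 * (A / H1) * (deriv h (x + √s * z) * e z)) stdGauss :=
      i1.const_mul _
    have j4 : Integrable (fun z => (A / H1) ^ 2 * e z) stdGauss := i4.const_mul _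
    have d1 : Integrable (fun z => 2 * (A / H1) * (deriv h (x + √s * z) * e z) -
      (A / H1) ^ 2 * e z) stdGauss := j1.sub j4
    rw [integral_sub i0 d1, integral_sub j1 j4, integral_const_mul, integral_const_mul,
      a1, a2] at key
    have e1 : Q - (2 * (A / H1) * A - (A / H1) ^ 2 * H1) = (Q * H1 - A * A) / H1 := by
      field_simp
      ring
    rw [e1] at key
    by_contra hcon
    push Not at hcon
    have : (Q * H1 - A * A) / H1 < 0 := div_neg_of_neg_of_pos (by linarith) hpos
    linarith
  have e2 : B / H1 - m * (A / H1) * (A / H1) = (B * H1 - m * A * A) / H1 ^ 2 := by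
    field_simp
  change -C ≤ B / H1 - m * (A / H1) * (A / H1)
  rw [e2, le_div_iff₀ (by positivity), eB]
  nlinarith [mul_le_mul_of_nonneg_left hQ' hm, mul_le_mul_of_nonneg_right hR' hpos.le]

end Moments

/-! ### Polynomial calculus -/

/-- Chain rule for polynomials in functions whose derivatives are polynomials. -/
lemma MvPolynomial.hasDerivAt_eval {σ : Type*} {y : ℝ → σ → ℝ} {x : ℝ}
    (D : Derivation ℝ (MvPolynomial σ ℝ) (MvPolynomial σ ℝ))
    (hy : ∀ i, HasDerivAt (fun x => y x i) (MvPolynomial.eval (y x) (D (MvPolynomial.X i))) x)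
    (P : MvPolynomial σ ℝ) :
    HasDerivAt (fun x => MvPolynomial.eval (y x) P) (MvPolynomial.eval (y x) (D P)) x := by
  induction P using MvPolynomial.induction_on with
  | C a => simpa using hasDerivAt_const x a
  | add p q hp hq =>
    simp only [map_add]
    exact hp.add hq
  | mul_X p i hp =>
    have := hp.mul (hy i)
    simp only [map_mul, MvPolynomial.eval_X, Derivation.leibniz, smul_eq_mul, map_add]
    exact this.congr_deriv (by ring)

lemma MvPolynomial.exists_abs_eval_le {σ ι : Type*} {T : Set ι} {y : ι → ℝ → σ → ℝ}
    (hy : ∀ i, ∃ C : ℝ, ∃ p : ℕ, 0 ≤ C ∧ ∀ t ∈ T, ∀ x, |y t x i| ≤ C * (1 + x ^ 2) ^ p)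
    (P : MvPolynomial σ ℝ) :
    ∃ C : ℝ, ∃ p : ℕ, 0 ≤ C ∧ ∀ t ∈ T, ∀ x, |MvPolynomial.eval (y t x) P| ≤ C * (1 + x ^ 2) ^ p := by
  induction P using MvPolynomial.induction_on with
  | C a => exact ⟨|a|, 0, abs_nonneg a, by simp⟩
  | add P Q hP hQ =>
    obtain ⟨C, p, hC, hP⟩ := hP
    obtain ⟨D, q, hD, hQ⟩ := hQ
    refine ⟨C + D, max p q, by positivity, fun t ht x => ?_⟩
    rw [map_add]
    calc _ ≤ _ := abs_add_le _ _
      _ ≤ C * (1 + x ^ 2) ^ (max p q) + D * (1 + x ^ 2) ^ (max p q) := by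
        refine add_le_add ((hP t ht x).trans ?_) ((hQ t ht x).trans ?_)
        · exact mul_le_mul_of_nonneg_left (weight_mono (le_max_left _ _) x) hC
        · exact mul_le_mul_of_nonneg_left (weight_mono (le_max_right _ _) x) hD
      _ = _ := by ring
  | mul_X P i hP =>
    obtain ⟨C, p, hC, hP⟩ := hP
    obtain ⟨D, q, hD, hQ⟩ := hy i
    refine ⟨C * D, p + q, by positivity, fun t ht x => ?_⟩
    rw [map_mul, MvPolynomial.eval_X, abs_mul, pow_add]
    calc _ ≤ (C * (1 + x ^ 2) ^ p) * (D * (1 + x ^ 2) ^ q) :=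
        mul_le_mul (hP t ht x) (hQ t ht x) (abs_nonneg _) (by positivity)
      _ = _ := by ring

lemma MvPolynomial.continuous_eval_comp {σ X : Type*} [TopologicalSpace X] {y : X → σ → ℝ}
    (hy : ∀ i, Continuous fun x => y x i) (P : MvPolynomial σ ℝ) :
    Continuous fun x => MvPolynomial.eval (y x) P :=
  (MvPolynomial.continuous_eval P).comp (continuous_pi hy)

/-! ### Solutions of the Parisi equation -/

/-- `φ` is a smooth solution of `∂ₜφ = -½(∂ₓ²φ + m(t)(∂ₓφ)²)` on `[a, b]`, with right
derivatives in time, all of whose space derivatives are continuous and polynomially bounded. -/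
structure ParisiSol (φ : ℝ → ℝ → ℝ) (m : ℝ → ℝ) (a b : ℝ) : Prop where
  smooth : ∀ t ∈ Set.Icc a b, ContDiff ℝ ∞ (φ t)
  cont : ∀ k, ContinuousOn (fun q : ℝ × ℝ => iteratedDeriv k (φ q.1) q.2) (Set.Icc a b ×ˢ Set.univ)
  growth : ∀ k, ∃ C : ℝ, ∃ p : ℕ, 0 ≤ C ∧ ∀ t ∈ Set.Icc a b, ∀ x,
    |iteratedDeriv k (φ t) x| ≤ C * (1 + x ^ 2) ^ p
  evol : ∀ k, ∀ t ∈ Set.Ico a b, ∀ x, HasDerivWithinAt (fun t => iteratedDeriv k (φ t) x)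
    (-(1 / 2) * (iteratedDeriv (k + 2) (φ t) x +
      m t * iteratedDeriv k (fun y => deriv (φ t) y * deriv (φ t) y) x)) (Set.Ici t) t

section OneStep

open MvPolynomial in
/-- Space derivation on polynomials in the tilted jets. -/
noncomputable def jetDx (m : ℝ) : Derivation ℝ (MvPolynomial ℕ ℝ) (MvPolynomial ℕ ℝ) :=
  mkDerivation ℝ fun j => X (j + 1) - C m * X j * X 0

open MvPolynomial in
/-- Time derivation on polynomials in the tilted jets. -/
noncomputable def jetDs (m : ℝ) : Derivation ℝ (MvPolynomial ℕ ℝ) (MvPolynomial ℕ ℝ) :=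
  mkDerivation ℝ fun j => X (j + 2) - C m * X j * X 1

open MvPolynomial in
lemma jetDx_comm (m : ℝ) (P : MvPolynomial ℕ ℝ) :
    jetDs m (jetDx m P) = jetDx m (jetDs m P) := by
  have h : ⁅jetDs m, jetDx m⁆ = 0 := by
    refine derivation_ext fun j => ?_
    have hC1 : ∀ c : ℝ, jetDx m (C c) = 0 := fun c => (jetDx m).map_algebraMap c
    have hC2 : ∀ c : ℝ, jetDs m (C c) = 0 := fun c => (jetDs m).map_algebraMap c
    have h1 : ∀ j, jetDx m (X j) = X (j + 1) - C m * X j * X 0 := fun j => mkDerivation_X _ _ _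
    have h2 : ∀ j, jetDs m (X j) = X (j + 2) - C m * X j * X 1 := fun j => mkDerivation_X _ _ _
    simp only [Derivation.commutator_apply, h1, h2, map_sub, Derivation.leibniz, smul_eq_mul, hC1,
      hC2, Derivation.zero_apply]
    ring
  have := congrArg (fun D => D P) h
  simpa [Derivation.commutator_apply, sub_eq_zero] using this

variable {m : ℝ} {h : ℝ → ℝ}

lemma hasDerivAt_eval_tiltJet (hm : 0 ≤ m) (hh : h.HasTemperateGrowth) (h0 : ∀ x, h x ≤ 0)
    (P : MvPolynomial ℕ ℝ) (s x : ℝ) :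
    HasDerivAt (fun x => MvPolynomial.eval (fun j => tiltJet m h j s x) P)
      (MvPolynomial.eval (fun j => tiltJet m h j s x) (jetDx m P)) x := by
  refine MvPolynomial.hasDerivAt_eval (jetDx m) (fun j => ?_) P
  simpa [jetDx, MvPolynomial.mkDerivation_X] using hasDerivAt_tiltJet hm hh h0 j s x

lemma hasDerivAt_eval_tiltJet_var (hm : 0 ≤ m) (hh : h.HasTemperateGrowth) (h0 : ∀ x, h x ≤ 0)
    (P : MvPolynomial ℕ ℝ) {s : ℝ} (hs : 0 < s) (x : ℝ) :
    HasDerivAt (fun s => MvPolynomial.eval (fun j => tiltJet m h j s x) P)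
      (1 / 2 * MvPolynomial.eval (fun j => tiltJet m h j s x) (jetDs m P)) s := by
  have key := MvPolynomial.hasDerivAt_eval (y := fun s j => tiltJet m h j s x) (x := s)
    ((1 / 2 : ℝ) • jetDs m) (fun j => ?_) P
  · simpa [MvPolynomial.smul_eval] using key
  · simpa [jetDs, MvPolynomial.mkDerivation_X, MvPolynomial.smul_eval] using
      hasDerivAt_tiltJet_var hm hh h0 j hs x

lemma iteratedDeriv_eval_tiltJet (hm : 0 ≤ m) (hh : h.HasTemperateGrowth) (h0 : ∀ x, h x ≤ 0)
    (P : MvPolynomial ℕ ℝ) (s : ℝ) (k : ℕ) :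
    iteratedDeriv k (fun x => MvPolynomial.eval (fun j => tiltJet m h j s x) P) =
      fun x => MvPolynomial.eval (fun j => tiltJet m h j s x) ((jetDx m)^[k] P) := by
  induction k generalizing P with
  | zero => simp
  | succ k ih =>
    rw [iteratedDeriv_succ', Function.iterate_succ_apply, ← ih]
    congr 1
    ext x
    exact (hasDerivAt_eval_tiltJet hm hh h0 P s x).deriv

lemma deriv_coleHopf (hm : 0 ≤ m) (hh : h.HasTemperateGrowth) (h0 : ∀ x, h x ≤ 0) (s : ℝ) :
    deriv (coleHopf m s h) =
      fun x => MvPolynomial.eval (fun j => tiltJet m h j s x) (MvPolynomial.X 0) := by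
  ext x
  rw [(coleHopf_hasDerivAt hm hh h0 s x).deriv, MvPolynomial.eval_X]

lemma iteratedDeriv_succ_coleHopf (hm : 0 ≤ m) (hh : h.HasTemperateGrowth) (h0 : ∀ x, h x ≤ 0)
    (s : ℝ) (k : ℕ) : iteratedDeriv (k + 1) (coleHopf m s h) =
      fun x => MvPolynomial.eval (fun j => tiltJet m h j s x)
        ((jetDx m)^[k] (MvPolynomial.X 0)) := by
  rw [iteratedDeriv_succ', deriv_coleHopf hm hh h0, iteratedDeriv_eval_tiltJet hm hh h0]

lemma contDiff_coleHopf (hm : 0 ≤ m) (hh : h.HasTemperateGrowth) (h0 : ∀ x, h x ≤ 0) (s : ℝ) :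
    ContDiff ℝ ∞ (coleHopf m s h) := by
  refine contDiff_of_differentiable_iteratedDeriv fun k _ => ?_
  rcases k with _ | k
  · rw [iteratedDeriv_zero]
    exact fun x => (coleHopf_hasDerivAt hm hh h0 s x).differentiableAt
  · rw [iteratedDeriv_succ_coleHopf hm hh h0]
    exact fun x => (hasDerivAt_eval_tiltJet hm hh h0 _ s x).differentiableAt

lemma continuous_iteratedDeriv_coleHopf (hm : 0 ≤ m) (hh : h.HasTemperateGrowth)
    (h0 : ∀ x, h x ≤ 0) (k : ℕ) :
    Continuous fun q : ℝ × ℝ => iteratedDeriv k (coleHopf m q.1 h) q.2 := by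
  rcases k with _ | k
  · simpa using continuous_coleHopf hm hh h0
  · simp only [iteratedDeriv_succ_coleHopf hm hh h0]
    exact MvPolynomial.continuous_eval_comp (fun j => continuous_tiltJet hm hh h0 j) _

lemma jet_one_eq (m : ℝ) : (MvPolynomial.X 1 : MvPolynomial ℕ ℝ) =
    jetDx m (MvPolynomial.X 0) +
      MvPolynomial.C m * (MvPolynomial.X 0 * MvPolynomial.X 0) := by
  simp only [jetDx, MvPolynomial.mkDerivation_X]
  ring

lemma eval_iterate_jet_one (hm : 0 ≤ m) (hh : h.HasTemperateGrowth) (h0 : ∀ x, h x ≤ 0)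
    (s x : ℝ) (k : ℕ) :
    MvPolynomial.eval (fun j => tiltJet m h j s x) ((jetDx m)^[k] (MvPolynomial.X 1)) =
      iteratedDeriv (k + 2) (coleHopf m s h) x + m * iteratedDeriv k
        (fun y => deriv (coleHopf m s h) y * deriv (coleHopf m s h) y) x := by
  have e1 : (fun y => deriv (coleHopf m s h) y * deriv (coleHopf m s h) y) =
      fun x => MvPolynomial.eval (fun j => tiltJet m h j s x)
        (MvPolynomial.X 0 * MvPolynomial.X 0) := by
    ext y
    rw [deriv_coleHopf hm hh h0, map_mul]
  rw [iteratedDeriv_succ_coleHopf hm hh h0, e1, iteratedDeriv_eval_tiltJet hm hh h0, jet_one_eq m]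
  have h1 : ∀ (k : ℕ) (P Q : MvPolynomial ℕ ℝ), (jetDx m)^[k] (P + MvPolynomial.C m * Q) =
      (jetDx m)^[k] P + MvPolynomial.C m * (jetDx m)^[k] Q := by
    intro k
    induction k with
    | zero => simp
    | succ k ih =>
      intro P Q
      have : jetDx m (MvPolynomial.C m) = 0 := (jetDx m).map_algebraMap m
      simp [Function.iterate_succ_apply, map_add, Derivation.leibniz, this, ih]
  rw [h1, map_add, map_mul, MvPolynomial.eval_C, Function.iterate_succ_apply]

lemma hasDerivAt_iteratedDeriv_coleHopf_var (hm : 0 ≤ m) (hh : h.HasTemperateGrowth)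
    (h0 : ∀ x, h x ≤ 0) (k : ℕ) {s : ℝ} (hs : 0 < s) (x : ℝ) :
    HasDerivAt (fun s => iteratedDeriv k (coleHopf m s h) x)
      (1 / 2 * (iteratedDeriv (k + 2) (coleHopf m s h) x + m * iteratedDeriv k
        (fun y => deriv (coleHopf m s h) y * deriv (coleHopf m s h) y) x)) s := by
  rw [← eval_iterate_jet_one hm hh h0]
  rcases k with _ | k
  · simpa using coleHopf_hasDerivAt_var hm hh h0 hs x
  · have h1 := hasDerivAt_eval_tiltJet_var hm hh h0 ((jetDx m)^[k] (MvPolynomial.X 0)) hs x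
    have h2 : jetDs m ((jetDx m)^[k] (MvPolynomial.X 0)) =
        (jetDx m)^[k + 1] (MvPolynomial.X 1) := by
      have hc : Function.Commute (jetDs m) (jetDx m) := jetDx_comm m
      rw [(hc.iterate_right k).eq, Function.iterate_succ_apply]
      congr 1
      simp [jetDs, jetDx, MvPolynomial.mkDerivation_X]
      ring
    rw [← h2]
    simpa only [iteratedDeriv_succ_coleHopf hm hh h0] using h1

lemma parisiSol_coleHopf (hm : 0 ≤ m) (hh : h.HasTemperateGrowth) (h0 : ∀ x, h x ≤ 0)
    (ha : Antitone (deriv h)) {a b : ℝ} (hab : a ≤ b) :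
    ParisiSol (fun t => coleHopf m (b - t) h) (fun _ => m) a b := by
  have hg : ∀ k, ∃ C : ℝ, ∃ p : ℕ, 0 ≤ C ∧ ∀ t ∈ Set.Icc a b, ∀ x,
      |iteratedDeriv (k + 1) (coleHopf m (b - t) h) x| ≤ C * (1 + x ^ 2) ^ p := by
    intro k
    simp only [iteratedDeriv_succ_coleHopf hm hh h0]
    refine MvPolynomial.exists_abs_eval_le
      (y := fun t x j => tiltJet m h j (b - t) x) (fun j => ?_) _
    obtain ⟨C, q, hC, hb⟩ := abs_tiltJet_le hm hh h0 ha (sub_nonneg.2 hab) j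
    exact ⟨C, q, hC, fun t ht x => hb _ (by linarith [ht.1]) x⟩
  have hc : ∀ k, Continuous fun q : ℝ × ℝ => iteratedDeriv k (coleHopf m (b - q.1) h) q.2 :=
    fun k => (continuous_iteratedDeriv_coleHopf hm hh h0 k).comp
      (g := fun q : ℝ × ℝ => iteratedDeriv k (coleHopf m q.1 h) q.2)
      (f := fun q : ℝ × ℝ => (b - q.1, q.2)) (by fun_prop)
  refine ⟨fun t _ => contDiff_coleHopf hm hh h0 _, fun k => (hc k).continuousOn, fun k => ?_,
    fun k t ht x => ?_⟩
  · rcases k with _ | k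
    · obtain ⟨C, p, hC, hb⟩ := hg 0
      have hc0 : Continuous fun t => |coleHopf m (b - t) h 0| := by
        have := (hc 0).comp (f := fun t : ℝ => (t, (0 : ℝ))) (by fun_prop)
        simpa [Function.comp_def] using this.abs
      obtain ⟨M, hM⟩ := (isCompact_Icc (a := a) (b := b)).bddAbove_image hc0.continuousOn
      have hM0 : ∀ t ∈ Set.Icc a b, |coleHopf m (b - t) h 0| ≤ M :=
        fun t ht => hM (Set.mem_image_of_mem _ ht)
      have hMn : 0 ≤ M := (abs_nonneg _).trans (hM0 a ⟨le_rfl, hab⟩)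
      refine ⟨M + C, p + 1, by positivity, fun t ht x => ?_⟩
      rw [iteratedDeriv_zero]
      refine abs_le_weight_of_hasDerivAt (fun y => (coleHopf_hasDerivAt hm hh h0 (b - t) y))
        (hM0 t ht) hC (fun y => ?_) x
      have h1 := hb t ht y
      rwa [zero_add, iteratedDeriv_one, (coleHopf_hasDerivAt hm hh h0 (b - t) y).deriv] at h1
    · exact hg k
  · have h1 := (hasDerivAt_iteratedDeriv_coleHopf_var hm hh h0 k (sub_pos.2 ht.2) x).comp t
      ((hasDerivAt_id t).const_sub b)
    refine (h1.congr_deriv ?_).hasDerivWithinAt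
    ring

end OneStep

namespace ParisiSol

lemma congr {φ ψ : ℝ → ℝ → ℝ} {m m' : ℝ → ℝ} {a b : ℝ} (hs : ParisiSol φ m a b)
    (h : ∀ t ∈ Set.Icc a b, ψ t = φ t) (hm : ∀ t ∈ Set.Ico a b, m' t = m t) :
    ParisiSol ψ m' a b := by
  refine ⟨fun t ht => by rw [h t ht]; exact hs.smooth t ht, fun k => (hs.cont k).congr ?_, ?_, ?_⟩
  · rintro ⟨t, x⟩ ⟨ht, -⟩
    simp only
    rw [h t ht]
  · intro k
    obtain ⟨C, p, hC, hb⟩ := hs.growth k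
    exact ⟨C, p, hC, fun t ht x => by rw [h t ht]; exact hb t ht x⟩
  · intro k t ht x
    rw [h t ⟨ht.1, ht.2.le⟩, hm t ht]
    refine (hs.evol k t ht x).congr_of_eventuallyEq ?_ (by rw [h t ⟨ht.1, ht.2.le⟩])
    filter_upwards [Ico_mem_nhdsGE ht.2] with u hu
    rw [h u ⟨ht.1.trans hu.1, hu.2.le⟩]

lemma glue {φ : ℝ → ℝ → ℝ} {m : ℝ → ℝ} {a b c : ℝ} (hab : a ≤ b) (hbc : b ≤ c)
    (h1 : ParisiSol φ m a b) (h2 : ParisiSol φ m b c) : ParisiSol φ m a c := by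
  have hu : Set.Icc a c = Set.Icc a b ∪ Set.Icc b c := (Set.Icc_union_Icc_eq_Icc hab hbc).symm
  refine ⟨fun t ht => ?_, fun k => ?_, fun k => ?_, fun k t ht x => ?_⟩
  · rw [hu] at ht
    exact ht.elim (h1.smooth t) (h2.smooth t)
  · rw [hu, Set.union_prod]
    exact (h1.cont k).union_of_isClosed (h2.cont k) (isClosed_Icc.prod isClosed_univ)
      (isClosed_Icc.prod isClosed_univ)
  · obtain ⟨C, p, hC, hb⟩ := h1.growth k
    obtain ⟨D, q, hD, hd⟩ := h2.growth k
    refine ⟨C + D, max p q, by positivity, fun t ht x => ?_⟩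
    have e1 := mul_le_mul_of_nonneg_left (weight_mono (le_max_left p q) x) hC
    have e2 := mul_le_mul_of_nonneg_left (weight_mono (le_max_right p q) x) hD
    have e3 : 0 ≤ (1 + x ^ 2) ^ (max p q) := by positivity
    rw [add_mul]
    rw [hu] at ht
    rcases ht with ht | ht
    · have := hb t ht x
      nlinarith [mul_nonneg hD e3]
    · have := hd t ht x
      nlinarith [mul_nonneg hC e3]
  · rcases lt_or_ge t b with htb | htb
    · exact h1.evol k t ⟨ht.1, htb⟩ x
    · exact h2.evol k t ⟨htb, ht.2⟩ x

end ParisiSol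

/-! ### The Gaussian tail -/

section Tail

lemma gaussTail_eq_integral (v : ℝ) : gaussTail v = ∫ z in Set.Ioi v, gaussianPDFReal 0 1 z := by
  rw [gaussTail, stdGauss, gaussianReal_apply_eq_integral 0 one_ne_zero, ENNReal.toReal_ofReal,
    integral_Ici_eq_integral_Ioi]
  exact integral_nonneg fun z => gaussianPDFReal_nonneg 0 1 z

lemma gaussTail_pos (v : ℝ) : 0 < gaussTail v := by
  rw [gaussTail_eq_integral, setIntegral_pos_iff_support_of_nonneg_ae
    (Eventually.of_forall fun z => gaussianPDFReal_nonneg 0 1 z)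
    (integrable_gaussianPDFReal 0 1).integrableOn]
  have : Function.support (gaussianPDFReal 0 1) = Set.univ := by
    ext z
    simpa using (gaussianPDFReal_pos 0 1 z one_ne_zero).ne'
  rw [this, Set.univ_inter, Real.volume_Ioi]
  exact ENNReal.zero_lt_top

lemma gaussTail_le_one (v : ℝ) : gaussTail v ≤ 1 := by
  rw [gaussTail]
  exact ENNReal.toReal_le_of_le_ofReal zero_le_one (by simpa using prob_le_one)

lemma hasDerivAt_gaussTail (v : ℝ) : HasDerivAt gaussTail (-gaussianPDFReal 0 1 v) v := by
  have hi := integrable_gaussianPDFReal 0 1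
  have hc : Continuous (gaussianPDFReal 0 1) :=
    continuous_iff_continuousAt.2 fun z => (hasDerivAt_gaussianPDFReal z).continuousAt
  have h1 : gaussTail = fun v => gaussTail 0 - ∫ z in (0 : ℝ)..v, gaussianPDFReal 0 1 z := by
    ext v
    rw [gaussTail_eq_integral, gaussTail_eq_integral,
      ← intervalIntegral.integral_interval_add_Ioi' (hi.intervalIntegrable (a := 0) (b := v))
        hi.integrableOn]
    ring
  rw [h1]
  exact (intervalIntegral.integral_hasDerivAt_right hi.intervalIntegrable
    (hc.stronglyMeasurableAtFilter _ _) hc.continuousAt).const_sub _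

lemma integral_Ioi_id_gaussianPDFReal (v : ℝ) :
    ∫ z in Set.Ioi v, gaussianPDFReal 0 1 z * z = gaussianPDFReal 0 1 v := by
  have i1 := PolyB.id.integrable_gaussianPDFReal_mul (by fun_prop)
  have hd : ∀ z : ℝ, HasDerivAt (fun z => -gaussianPDFReal 0 1 z) (gaussianPDFReal 0 1 z * z) z :=
    fun z => (hasDerivAt_gaussianPDFReal z).neg.congr_deriv (by ring)
  rw [integral_Ioi_of_hasDerivAt_of_tendsto' (fun z _ => hd z) i1.integrableOn
    (tendsto_zero_of_hasDerivAt_of_integrableOn_Ioi (a := v) (fun z _ => hd z) i1.integrableOn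
      (integrable_gaussianPDFReal 0 1).neg.integrableOn)]
  ring

lemma integral_Ioi_sq_gaussianPDFReal (v : ℝ) :
    ∫ z in Set.Ioi v, gaussianPDFReal 0 1 z * (z * z) = v * gaussianPDFReal 0 1 v + gaussTail v := by
  have i0 := integrable_gaussianPDFReal 0 1
  have i1 := PolyB.id.integrable_gaussianPDFReal_mul (by fun_prop)
  have i2 := (PolyB.id.mul PolyB.id).integrable_gaussianPDFReal_mul (by fun_prop)
  have hd : ∀ z : ℝ, HasDerivAt (fun z => -(gaussianPDFReal 0 1 z * z))
      (gaussianPDFReal 0 1 z * (z * z) - gaussianPDFReal 0 1 z) z :=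
    fun z => ((hasDerivAt_gaussianPDFReal z).mul (hasDerivAt_id z)).neg.congr_deriv
      (by simp; ring)
  have hi : Integrable fun z => gaussianPDFReal 0 1 z * (z * z) - gaussianPDFReal 0 1 z := i2.sub i0
  have h := integral_Ioi_of_hasDerivAt_of_tendsto' (a := v) (fun z _ => hd z) hi.integrableOn
    (tendsto_zero_of_hasDerivAt_of_integrableOn_Ioi (a := v) (fun z _ => hd z) hi.integrableOn
      i1.neg.integrableOn)
  rw [integral_sub i2.integrableOn i0.integrableOn, ← gaussTail_eq_integral] at h
  linarith

/-- The inverse Mills ratio. -/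
noncomputable def hazard (v : ℝ) : ℝ := gaussianPDFReal 0 1 v / gaussTail v

lemma hazard_pos (v : ℝ) : 0 < hazard v :=
  div_pos (gaussianPDFReal_pos 0 1 v one_ne_zero) (gaussTail_pos v)

lemma hazard_mul (v : ℝ) : gaussianPDFReal 0 1 v = hazard v * gaussTail v := by
  rw [hazard, div_mul_cancel₀ _ (gaussTail_pos v).ne']

lemma le_hazard (v : ℝ) : v ≤ hazard v := by
  have i0 := integrable_gaussianPDFReal 0 1
  have i1 := PolyB.id.integrable_gaussianPDFReal_mul (by fun_prop)
  have h : 0 ≤ ∫ z in Set.Ioi v, (gaussianPDFReal 0 1 z * z - v * gaussianPDFReal 0 1 z) := by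
    refine setIntegral_nonneg measurableSet_Ioi fun z hz => ?_
    have hz : v < z := hz
    nlinarith [gaussianPDFReal_nonneg 0 1 z]
  rw [integral_sub i1.integrableOn (i0.const_mul v).integrableOn, integral_const_mul,
    integral_Ioi_id_gaussianPDFReal, ← gaussTail_eq_integral, hazard_mul, ← sub_mul] at h
  have := nonneg_of_mul_nonneg_left h (gaussTail_pos v)
  linarith

lemma hazard_mul_sub_le (v : ℝ) : hazard v * (hazard v - v) ≤ 1 := by
  have i0 := integrable_gaussianPDFReal 0 1
  have i1 := PolyB.id.integrable_gaussianPDFReal_mul (by fun_prop)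
  have i2 := (PolyB.id.mul PolyB.id).integrable_gaussianPDFReal_mul (by fun_prop)
  have h : 0 ≤ ∫ z in Set.Ioi v, (gaussianPDFReal 0 1 z * (z * z) -
      (2 * hazard v * (gaussianPDFReal 0 1 z * z) - hazard v ^ 2 * gaussianPDFReal 0 1 z)) := by
    refine setIntegral_nonneg measurableSet_Ioi fun z _ => ?_
    have := mul_nonneg (gaussianPDFReal_nonneg 0 1 z) (sq_nonneg (z - hazard v))
    linarith
  have i3 : Integrable fun z => 2 * hazard v * (gaussianPDFReal 0 1 z * z) := i1.const_mul _
  have i4 : Integrable fun z => hazard v ^ 2 * gaussianPDFReal 0 1 z := i0.const_mul _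
  have i5 : Integrable fun z => 2 * hazard v * (gaussianPDFReal 0 1 z * z) -
    hazard v ^ 2 * gaussianPDFReal 0 1 z := i3.sub i4
  rw [integral_sub i2.integrableOn i5.integrableOn, integral_sub i3.integrableOn i4.integrableOn,
    integral_const_mul, integral_const_mul, integral_Ioi_id_gaussianPDFReal,
    integral_Ioi_sq_gaussianPDFReal, ← gaussTail_eq_integral, hazard_mul] at h
  have h2 : 0 ≤ (1 - hazard v * (hazard v - v)) * gaussTail v := by linarith
  have := nonneg_of_mul_nonneg_left h2 (gaussTail_pos v)
  linarith

lemma hazard_le (v : ℝ) : hazard v ≤ |v| + 1 := by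
  by_contra! h
  have h1 := hazard_mul_sub_le v
  have h2 := le_abs_self v
  have h3 := abs_nonneg v
  nlinarith

lemma hasDerivAt_hazard (v : ℝ) : HasDerivAt hazard (hazard v * (hazard v - v)) v := by
  have hp := gaussTail_pos v
  refine ((hasDerivAt_gaussianPDFReal v).div (hasDerivAt_gaussTail v) hp.ne').congr_deriv ?_
  rw [hazard_mul]
  field_simp
  ring

lemma hasDerivAt_log_gaussTail (v : ℝ) :
    HasDerivAt (fun v => Real.log (gaussTail v)) (-hazard v) v := by
  refine ((hasDerivAt_gaussTail v).log (gaussTail_pos v).ne').congr_deriv ?_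
  rw [hazard, neg_div]

/-- The terminal condition at scale `a⁻¹`. -/
noncomputable def logTail (κ a x : ℝ) : ℝ := Real.log (gaussTail ((κ - x) / a))

lemma logTail_nonpos (κ a x : ℝ) : logTail κ a x ≤ 0 :=
  Real.log_nonpos (gaussTail_pos _).le (gaussTail_le_one _)

lemma hasDerivAt_hazard_comp (κ a x : ℝ) : HasDerivAt (fun x => hazard ((κ - x) / a))
    (-a⁻¹ * hazard ((κ - x) / a) * (hazard ((κ - x) / a) - (κ - x) / a)) x := by
  have h1 : HasDerivAt (fun x => (κ - x) / a) (-1 / a) x :=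
    ((hasDerivAt_id x).const_sub κ).div_const a
  refine ((hasDerivAt_hazard _).comp x h1).congr_deriv ?_
  ring

lemma hasDerivAt_logTail (κ a x : ℝ) :
    HasDerivAt (logTail κ a) (a⁻¹ * hazard ((κ - x) / a)) x := by
  have h1 : HasDerivAt (fun x => (κ - x) / a) (-1 / a) x :=
    ((hasDerivAt_id x).const_sub κ).div_const a
  refine ((hasDerivAt_log_gaussTail _).comp x h1).congr_deriv ?_
  ring

lemma deriv_deriv_logTail (κ a x : ℝ) : deriv (deriv (logTail κ a)) x =
    -(a⁻¹ ^ 2 * (hazard ((κ - x) / a) * (hazard ((κ - x) / a) - (κ - x) / a))) := by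
  have h1 : deriv (logTail κ a) = fun x => a⁻¹ * hazard ((κ - x) / a) := by
    ext x; exact (hasDerivAt_logTail κ a x).deriv
  rw [h1, ((hasDerivAt_hazard_comp κ a x).const_mul _).deriv]
  ring

lemma deriv_deriv_logTail_nonpos (κ a x : ℝ) : deriv (deriv (logTail κ a)) x ≤ 0 := by
  rw [deriv_deriv_logTail]
  have := mul_nonneg (hazard_pos ((κ - x) / a)).le (sub_nonneg.2 (le_hazard ((κ - x) / a)))
  have := mul_nonneg (sq_nonneg a⁻¹) this
  linarith

lemma le_deriv_deriv_logTail (κ a x : ℝ) : -(a⁻¹ ^ 2) ≤ deriv (deriv (logTail κ a)) x := by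
  rw [deriv_deriv_logTail]
  have := mul_le_mul_of_nonneg_left (hazard_mul_sub_le ((κ - x) / a)) (sq_nonneg a⁻¹)
  linarith

open MvPolynomial in
/-- The derivation on polynomials in the hazard rate and its argument. -/
noncomputable def hazardDx (a : ℝ) :
    Derivation ℝ (MvPolynomial (Fin 2) ℝ) (MvPolynomial (Fin 2) ℝ) :=
  mkDerivation ℝ ![-C a⁻¹ * X 0 * (X 0 - X 1), -C a⁻¹]

lemma hasTemperateGrowth_logTail (κ a : ℝ) : (logTail κ a).HasTemperateGrowth := by
  set y : ℝ → Fin 2 → ℝ := fun x => ![hazard ((κ - x) / a), (κ - x) / a] with hy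
  have hb : ∀ P : MvPolynomial (Fin 2) ℝ, PolyB fun x => MvPolynomial.eval (y x) P := by
    intro P
    have h1 : PolyB fun x => (κ - x) / a := by
      have := (PolyB.const a⁻¹).mul ((PolyB.const κ).add PolyB.id.neg)
      refine this.of_le fun x => le_of_eq ?_
      congr 1
      rw [div_eq_inv_mul, sub_eq_add_neg]
    have h2 : PolyB fun x => hazard ((κ - x) / a) := by
      obtain ⟨C, p, hC, h1⟩ := h1
      refine ⟨C + 1, p, by positivity, fun x => ?_⟩
      rw [abs_of_pos (hazard_pos _)]
      have := h1 x
      have := hazard_le ((κ - x) / a)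
      have := one_le_weight p x
      linarith
    obtain ⟨C, p, hC, h⟩ := MvPolynomial.exists_abs_eval_le (T := (Set.univ : Set Unit))
      (y := fun _ => y) (fun i => by
        fin_cases i
        · obtain ⟨C, p, hC, h2⟩ := h2
          exact ⟨C, p, hC, fun _ _ x => h2 x⟩
        · obtain ⟨C, p, hC, h1⟩ := h1
          exact ⟨C, p, hC, fun _ _ x => h1 x⟩) P
    exact ⟨C, p, hC, h () trivial⟩
  have hd : ∀ (P : MvPolynomial (Fin 2) ℝ) (x : ℝ),
      HasDerivAt (fun x => MvPolynomial.eval (y x) P)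
        (MvPolynomial.eval (y x) (hazardDx a P)) x := by
    intro P x
    refine MvPolynomial.hasDerivAt_eval (hazardDx a) (fun i => ?_) P
    fin_cases i
    · simpa [hazardDx, MvPolynomial.mkDerivation_X, hy] using hasDerivAt_hazard_comp κ a x
    · have : HasDerivAt (fun x => (κ - x) / a) (-1 / a) x :=
        ((hasDerivAt_id x).const_sub κ).div_const a
      simpa [hazardDx, MvPolynomial.mkDerivation_X, hy, neg_div] using this
  let Y : ℕ → ℝ → ℝ := fun k => match k with
    | 0 => logTail κ a
    | k + 1 => fun x => MvPolynomial.eval (y x)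
      ((hazardDx a)^[k] (MvPolynomial.C a⁻¹ * MvPolynomial.X 0))
  refine hasTemperateGrowth_of_seq (y := Y) (fun k x => ?_) fun k => ?_
  · rcases k with _ | k
    · simpa [Y, hy] using hasDerivAt_logTail κ a x
    · simpa only [Y, Function.iterate_succ_apply'] using hd _ x
  · rcases k with _ | k
    · obtain ⟨C, p, hC, hb⟩ := hb (MvPolynomial.C a⁻¹ * MvPolynomial.X 0)
      refine ⟨|logTail κ a 0| + C, p + 1, by positivity, abs_le_weight_of_hasDerivAt
        (hasDerivAt_logTail κ a) le_rfl hC fun z => ?_⟩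
      simpa [hy] using hb z
    · exact hb _

lemma gaussTail_div_sqrt {c : ℝ} (hc : 0 < c) (v : ℝ) :
    gaussTail (v / √c) = (gaussianReal 0 (.mk c hc.le) (Set.Ici v)).toReal := by
  have h1 := gaussianReal_map_const_mul (μ := 0) (v := 1) (√c)
  have h2 : (.mk (√c ^ 2) (sq_nonneg _) * 1 : NNReal) = NNReal.mk c hc.le := by
    ext; simp [Real.sq_sqrt hc.le]
  rw [h2, mul_zero] at h1
  rw [← h1, Measure.map_apply (by fun_prop) measurableSet_Ici, gaussTail, stdGauss]
  congr 2
  ext z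
  rw [Set.mem_Ici, Set.mem_preimage, Set.mem_Ici, div_le_iff₀' (Real.sqrt_pos.2 hc)]

/-- Stability of the Gaussian tail under Gaussian smoothing. -/
lemma integral_gaussTail_shift {s c : ℝ} (hs : 0 ≤ s) (hc : 0 < c) (v : ℝ) :
    ∫ z, gaussTail ((v - √s * z) / √c) ∂stdGauss = gaussTail (v / √(s + c)) := by
  rcases hs.eq_or_lt with rfl | hs
  · simp
  have hsc : 0 < s + c := by positivity
  have h1 := gaussianReal_map_const_mul (μ := 0) (v := 1) (√s)
  have h2 : (.mk (√s ^ 2) (sq_nonneg _) * 1 : NNReal) = NNReal.mk s hs.le := by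
    ext; simp [Real.sq_sqrt hs.le]
  rw [h2, mul_zero] at h1
  have h3 : gaussianReal 0 (.mk (s + c) hsc.le) =
      (gaussianReal 0 (.mk s hs.le)).conv (gaussianReal 0 (.mk c hc.le)) := by
    rw [gaussianReal_conv_gaussianReal, add_zero]
    rfl
  have hmeas : Measurable fun z => gaussTail ((v - √s * z) / √c) := by
    have : Continuous gaussTail :=
      continuous_iff_continuousAt.2 fun z => (hasDerivAt_gaussTail z).continuousAt
    fun_prop
  rw [gaussTail_div_sqrt hsc, h3, ← lintegral_indicator_one measurableSet_Ici,
    Measure.lintegral_conv (measurable_one.indicator measurableSet_Ici), ← h1,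
    integral_eq_lintegral_of_nonneg_ae (Eventually.of_forall fun z => (gaussTail_pos _).le)
      hmeas.aestronglyMeasurable]
  have h4 : ∀ x, ∫⁻ y, (Set.Ici v).indicator 1 (x + y) ∂(gaussianReal 0 (.mk c hc.le)) =
      ENNReal.ofReal (gaussTail ((v - x) / √c)) := by
    intro x
    rw [gaussTail_div_sqrt hc, ENNReal.ofReal_toReal (measure_ne_top _ _),
      ← lintegral_indicator_one measurableSet_Ici]
    refine lintegral_congr fun y => ?_
    simp only [Set.indicator, Set.mem_Ici, sub_le_iff_le_add', Pi.one_apply]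
  simp only [h4]
  rw [lintegral_map _ (by fun_prop)]
  · rfl
  · have : Continuous gaussTail :=
      continuous_iff_continuousAt.2 fun z => (hasDerivAt_gaussTail z).continuousAt
    fun_prop

lemma coleHopf_one_logTail {s c : ℝ} (hs : 0 ≤ s) (hc : 0 < c) (κ x : ℝ) :
    coleHopf 1 s (logTail κ (√c)) x = logTail κ (√(s + c)) x := by
  simp only [coleHopf, zero_lt_one, if_true, div_one, one_mul, logTail,
    Real.exp_log (gaussTail_pos _)]
  rw [← integral_gaussTail_shift hs hc]
  congr 2
  ext z
  ring_nf

end Tail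

/-! ### The recursive solution solves the Parisi equation -/

/-- Smooth nonpositive concave functions with second derivative bounded below by `-C`. -/
structure ConcaveData (C : ℝ) (h : ℝ → ℝ) : Prop where
  temperate : h.HasTemperateGrowth
  nonpos : ∀ x, h x ≤ 0
  deriv2_nonpos : ∀ x, deriv (deriv h) x ≤ 0
  le_deriv2 : ∀ x, -C ≤ deriv (deriv h) x

namespace ConcaveData

lemma antitone {C : ℝ} {h : ℝ → ℝ} (hh : ConcaveData C h) : Antitone (deriv h) :=
  antitone_of_deriv_nonpos hh.temperate.real_deriv.differentiable_real hh.deriv2_nonpos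

lemma coleHopf {C m s : ℝ} {h : ℝ → ℝ} (hh : ConcaveData C h) (hm : 0 ≤ m) (hs : 0 ≤ s) :
    ConcaveData C (coleHopf m s h) := by
  rcases hs.eq_or_lt with rfl | hs
  · rwa [show _root_.coleHopf m 0 h = h from funext fun x => coleHopf_zero_var hm x]
  have hd : deriv (_root_.coleHopf m s h) = tiltJet m h 0 s := by
    ext x; exact (coleHopf_hasDerivAt hm hh.temperate hh.nonpos s x).deriv
  have hdd : ∀ x, deriv (deriv (_root_.coleHopf m s h)) x =
      tiltJet m h 1 s x - m * tiltJet m h 0 s x * tiltJet m h 0 s x := by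
    intro x
    rw [hd, (hasDerivAt_tiltJet hm hh.temperate hh.nonpos 0 s x).deriv]
  refine ⟨?_, coleHopf_nonpos hm hh.temperate hh.nonpos s, fun x => ?_, fun x => ?_⟩
  · rw [hasTemperateGrowth_iff_polyB]
    refine ⟨contDiff_coleHopf hm hh.temperate hh.nonpos s, fun k => ?_⟩
    obtain ⟨C, p, hC, hb⟩ := (parisiSol_coleHopf hm hh.temperate hh.nonpos hh.antitone hs.le).growth k
    refine ⟨C, p, hC, fun x => ?_⟩
    simpa using hb 0 ⟨le_rfl, hs.le⟩ x
  · rw [hdd]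
    exact tiltJet_one_sub_nonpos hm hh.temperate hh.nonpos hh.antitone hs x
  · rw [hdd]
    exact le_tiltJet_one_sub hm hh.temperate hh.nonpos hh.le_deriv2 s x

end ConcaveData

lemma concaveData_logTail (κ a : ℝ) : ConcaveData (a⁻¹ ^ 2) (logTail κ a) :=
  ⟨hasTemperateGrowth_logTail κ a, logTail_nonpos κ a, deriv_deriv_logTail_nonpos κ a,
    le_deriv_deriv_logTail κ a⟩

namespace StepFn

variable (γ : StepFn)

lemma q_mono {i j : ℕ} (hij : i ≤ j) (hj : j ≤ γ.n + 1) : γ.q i ≤ γ.q j := by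
  induction j, hij using Nat.le_induction with
  | base => exact le_rfl
  | succ j _ ih => exact (ih (by omega)).trans (γ.q_lt j (by omega)).le

lemma m_le {i j : ℕ} (hij : i ≤ j) (hj : j ≤ γ.n) : γ.m i ≤ γ.m j := by
  induction j, hij using Nat.le_induction with
  | base => exact le_rfl
  | succ j _ ih => exact (ih (by omega)).trans (γ.m_mono j (by omega))

lemma m_nonneg {i : ℕ} (hi : i ≤ γ.n) : 0 ≤ γ.m i := γ.m_zero ▸ γ.m_le (Nat.zero_le i) hi

lemma m_le_one {i : ℕ} (hi : i ≤ γ.n) : γ.m i ≤ 1 := γ.m_last ▸ γ.m_le hi le_rfl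

lemma qbar_lt_one : γ.qbar < 1 := γ.q_last ▸ γ.q_lt γ.n le_rfl

lemma qbar_nonneg : 0 ≤ γ.qbar := γ.q_zero ▸ γ.q_mono (Nat.zero_le γ.n) (by omega)

lemma findGreatest_eq {t : ℝ} [DecidablePred fun i => γ.q i ≤ t] {i : ℕ} (hi : i ≤ γ.n)
    (h1 : γ.q i ≤ t) (h2 : i < γ.n → t < γ.q (i + 1)) :
    Nat.findGreatest (fun i => γ.q i ≤ t) γ.n = i := by
  rw [Nat.findGreatest_eq_iff]
  refine ⟨hi, fun _ => h1, fun j hij hj => not_le.2 ?_⟩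
  exact (h2 (by omega)).trans_le (γ.q_mono hij (by omega))

open Classical in
/-- The right-continuous monotone extension of `γ` to the line. -/
noncomputable def level (t : ℝ) : ℝ := γ.m (Nat.findGreatest (fun i => γ.q i ≤ t) γ.n)

lemma level_nonneg (t : ℝ) : 0 ≤ γ.level t := γ.m_nonneg (Nat.findGreatest_le _)

lemma level_le_one (t : ℝ) : γ.level t ≤ 1 := γ.m_le_one (Nat.findGreatest_le _)

lemma level_mono : Monotone γ.level := fun _ _ hst =>
  γ.m_le (Nat.findGreatest_mono_left (fun _ h => h.trans hst) _) (Nat.findGreatest_le _)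

lemma continuousWithinAt_level (t : ℝ) : ContinuousWithinAt γ.level (Set.Ici t) t := by
  classical
  refine (continuousWithinAt_const (b := γ.level t)).congr_of_eventuallyEq ?_ rfl
  have : ∃ u > t, ∀ s ∈ Set.Ico t u, γ.level s = γ.level t := by
    rcases (Nat.findGreatest_le (P := fun i => γ.q i ≤ t) γ.n).eq_or_lt with h | h
    · refine ⟨t + 1, by linarith, fun s hs => le_antisymm ?_ (γ.level_mono hs.1)⟩
      refine γ.m_le ?_ (Nat.findGreatest_le _)
      rw [h]
      exact Nat.findGreatest_le _
    · refine ⟨γ.q (Nat.findGreatest (fun i => γ.q i ≤ t) γ.n + 1), ?_, fun s hs => ?_⟩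
      · exact not_le.1 (Nat.findGreatest_is_greatest (P := fun i => γ.q i ≤ t) (Nat.lt_succ_self _) h)
      · refine le_antisymm (γ.m_le ?_ (Nat.findGreatest_le _)) (γ.level_mono hs.1)
        by_contra! hlt
        have h1 : γ.q (Nat.findGreatest (fun i => γ.q i ≤ s) γ.n) ≤ s :=
          Nat.findGreatest_of_ne_zero (P := fun i => γ.q i ≤ s) rfl (by omega)
        exact (hs.2.trans_le (γ.q_mono hlt
          ((Nat.findGreatest_le _).trans (Nat.le_succ _)))).not_ge h1
  obtain ⟨u, hu, h⟩ := this
  filter_upwards [Ico_mem_nhdsGE hu] with s hs using h s hs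

lemma level_eq {t : ℝ} {i : ℕ} (hi : i ≤ γ.n)
    (h1 : γ.q i ≤ t) (h2 : i < γ.n → t < γ.q (i + 1)) : γ.level t = γ.m i := by
  rw [level, γ.findGreatest_eq hi h1 h2]

lemma Phi_eq {κ t : ℝ} {i : ℕ} (hi : i ≤ γ.n)
    (h1 : γ.q i ≤ t) (h2 : i < γ.n → t < γ.q (i + 1)) : γ.Phi κ t = γ.PhiAux κ (γ.n - i) t := by
  ext x
  rw [Phi, γ.findGreatest_eq hi h1 h2]

lemma toFun_eq_level {t : ℝ} (ht : t ∈ Set.Ico (0 : ℝ) 1) : γ.toFun t = γ.level t := by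
  rw [toFun, if_pos ht, level]

variable {qb : ℝ} (κ : ℝ)

lemma Phi_eq_coleHopf_last (hqb : qb < 1) {t : ℝ} (ht : t ∈ Set.Icc γ.qbar qb) :
    γ.Phi κ t = coleHopf 1 (qb - t) (logTail κ √(1 - qb)) := by
  rw [γ.Phi_eq le_rfl ht.1 fun h => absurd h (lt_irrefl _), Nat.sub_self]
  ext x
  rw [coleHopf_one_logTail (sub_nonneg.2 ht.2) (sub_pos.2 hqb)]
  simp [PhiAux, logTail]

lemma Phi_eq_coleHopf {j : ℕ} (hj : j + 1 ≤ γ.n) {t : ℝ}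
    (ht : t ∈ Set.Icc (γ.q (γ.n - (j + 1))) (γ.q (γ.n - j))) :
    γ.Phi κ t = coleHopf (γ.m (γ.n - (j + 1))) (γ.q (γ.n - j) - t) (γ.Phi κ (γ.q (γ.n - j))) := by
  have e1 : γ.Phi κ (γ.q (γ.n - j)) = γ.PhiAux κ j (γ.q (γ.n - j)) := by
    rw [γ.Phi_eq (i := γ.n - j) (by omega) le_rfl fun h => γ.q_lt _ (by omega)]
    congr 1; omega
  rcases ht.2.eq_or_lt with h | h
  · ext x
    rw [h, sub_self, coleHopf_zero_var (γ.m_nonneg (by omega))]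
  · have e2 : γ.n - (j + 1) + 1 = γ.n - j := by omega
    rw [γ.Phi_eq (i := γ.n - (j + 1)) (by omega) ht.1 fun _ => by rwa [e2], e1]
    have e3 : γ.n - (γ.n - (j + 1)) = j + 1 := by omega
    rw [e3]
    rfl

/-- The recursive solution is a smooth concave solution of the Parisi equation. -/
lemma parisiSol_Phi (hq : γ.qbar ≤ qb) (hqb : qb < 1) :
    ParisiSol (γ.Phi κ) γ.level 0 qb ∧
      ∀ t ∈ Set.Icc 0 qb, ConcaveData ((√(1 - qb))⁻¹ ^ 2) (γ.Phi κ t) := by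
  have key : ∀ j ≤ γ.n, ParisiSol (γ.Phi κ) γ.level (γ.q (γ.n - j)) qb ∧
      ∀ t ∈ Set.Icc (γ.q (γ.n - j)) qb, ConcaveData ((√(1 - qb))⁻¹ ^ 2) (γ.Phi κ t) := by
    intro j
    induction j with
    | zero =>
      intro _
      have hd := concaveData_logTail κ √(1 - qb)
      refine ⟨(parisiSol_coleHopf zero_le_one hd.temperate hd.nonpos hd.antitone hq).congr
        (fun t ht => γ.Phi_eq_coleHopf_last κ hqb ht) fun t ht => ?_, fun t ht => ?_⟩
      · rw [γ.level_eq le_rfl ht.1 fun h => absurd h (lt_irrefl _), γ.m_last]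
      · rw [γ.Phi_eq_coleHopf_last κ hqb ht]
        exact hd.coleHopf zero_le_one (sub_nonneg.2 ht.2)
    | succ j ih =>
      intro hj
      obtain ⟨ih1, ih2⟩ := ih (by omega)
      have hle : γ.q (γ.n - j) ≤ qb := (γ.q_mono (Nat.sub_le _ _) (by omega)).trans hq
      have hd := ih2 (γ.q (γ.n - j)) ⟨le_rfl, hle⟩
      have hm : 0 ≤ γ.m (γ.n - (j + 1)) := γ.m_nonneg (by omega)
      have hlt : γ.q (γ.n - (j + 1)) ≤ γ.q (γ.n - j) := γ.q_mono (by omega) (by omega)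
      have e2 : γ.n - (j + 1) + 1 = γ.n - j := by omega
      refine ⟨ParisiSol.glue hlt hle
        ((parisiSol_coleHopf hm hd.temperate hd.nonpos hd.antitone hlt).congr
        (fun t ht => γ.Phi_eq_coleHopf κ hj ht) fun t ht => ?_) ih1, fun t ht => ?_⟩
      · exact γ.level_eq (by omega) ht.1 fun _ => by rw [e2]; exact ht.2
      · rcases le_total t (γ.q (γ.n - j)) with h | h
        · rw [γ.Phi_eq_coleHopf κ hj ⟨ht.1, h⟩]
          exact hd.coleHopf hm (sub_nonneg.2 h)
        · exact ih2 t ⟨h, ht.2⟩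
  simpa [γ.q_zero] using key γ.n le_rfl

lemma Phi_terminal (hq : γ.qbar ≤ qb) (hqb : qb < 1) : γ.Phi κ qb = logTail κ √(1 - qb) := by
  rw [γ.Phi_eq_coleHopf_last κ hqb ⟨hq, le_rfl⟩, sub_self]
  exact funext fun x => coleHopf_zero_var zero_le_one x

lemma intervalIntegrable_level_sub (γ₁ γ₂ : StepFn) (a b : ℝ) :
    IntervalIntegrable (fun s => |γ₁.level s - γ₂.level s|) volume a b :=
  (γ₁.level_mono.intervalIntegrable.sub γ₂.level_mono.intervalIntegrable).abs

lemma integral_level_sub_le (γ₁ γ₂ : StepFn) (h0 : 0 ≤ qb) (hqb : qb ≤ 1) :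
    ∫ s in (0 : ℝ)..qb, |γ₁.level s - γ₂.level s| ≤
      ∫ s in (0 : ℝ)..1, |γ₁.toFun s - γ₂.toFun s| := by
  have h1 : ∫ s in (0 : ℝ)..1, |γ₁.toFun s - γ₂.toFun s| =
      ∫ s in (0 : ℝ)..1, |γ₁.level s - γ₂.level s| := by
    refine intervalIntegral.integral_congr_ae ?_
    have : ∀ᵐ s : ℝ, s ≠ 1 := by simp [ae_iff]
    filter_upwards [this] with s hs hmem
    rw [Set.uIoc_of_le zero_le_one] at hmem
    have hm : s ∈ Set.Ico (0 : ℝ) 1 := ⟨hmem.1.le, lt_of_le_of_ne hmem.2 hs⟩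
    rw [γ₁.toFun_eq_level hm, γ₂.toFun_eq_level hm]
  rw [h1]
  exact intervalIntegral.integral_mono_interval le_rfl h0 hqb
    (Eventually.of_forall fun s => abs_nonneg _) (intervalIntegrable_level_sub γ₁ γ₂ 0 1)

end StepFn

/-! ### A maximum principle with polynomial weights -/

lemma IsLocalMax.second_deriv_nonpos {f f' : ℝ → ℝ} {f'' x : ℝ} (h : IsLocalMax f x)
    (h1 : ∀ y, HasDerivAt f (f' y) y) (h2 : HasDerivAt f' f'' x) : f'' ≤ 0 := by
  by_contra! hpos
  have e : deriv f = f' := funext fun y => (h1 y).deriv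
  have hmin : IsLocalMin f x := isLocalMin_of_deriv_deriv_pos (by rwa [e, h2.deriv])
    h.deriv_eq_zero (h1 x).continuousAt
  have hc : f =ᶠ[𝓝 x] fun _ => f x := by
    filter_upwards [h, hmin] with y hy hy' using le_antisymm hy hy'
  have := hc.deriv.deriv_eq
  simp [e, h2.deriv] at this
  exact hpos.ne' this

lemma HasDerivWithinAt.nonpos_of_le {f : ℝ → ℝ} {f' t u : ℝ} (htu : t < u)
    (h : HasDerivWithinAt f f' (Set.Ici t) t) (hf : ∀ s ∈ Set.Ioo t u, f s ≤ f t) : f' ≤ 0 := by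
  have := (hasDerivWithinAt_iff_tendsto_slope' (by simp)).1 h.Ioi_of_Ici
  refine le_of_tendsto this ?_
  filter_upwards [Ioo_mem_nhdsGT htu] with s hs
  rw [slope_def_field]
  exact div_nonpos_of_nonpos_of_nonneg (sub_nonpos.2 (hf s hs)) (sub_nonneg.2 hs.1.le)

/-- A function that is negative at the final time and at infinity stays negative if it cannot
have a vanishing spatial maximum from which it decreases in time. -/
lemma neg_of_no_touching {T : ℝ} {D D1 D2 Dt : ℝ → ℝ → ℝ}
    (hcont : ContinuousOn (fun q : ℝ × ℝ => D q.1 q.2) (Set.Icc 0 T ×ˢ Set.univ))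
    (hT : ∀ x, D T x < 0) (hinf : ∃ M, ∀ t ∈ Set.Icc 0 T, ∀ x, M < |x| → D t x < 0)
    (h1 : ∀ t ∈ Set.Ico 0 T, ∀ x, HasDerivAt (D t) (D1 t x) x)
    (h2 : ∀ t ∈ Set.Ico 0 T, ∀ x, HasDerivAt (D1 t) (D2 t x) x)
    (ht : ∀ t ∈ Set.Ico 0 T, ∀ x, HasDerivWithinAt (fun t => D t x) (Dt t x) (Set.Ici t) t)
    (hno : ∀ t ∈ Set.Ico 0 T, ∀ x, D t x = 0 → D1 t x = 0 → D2 t x ≤ 0 → ¬ Dt t x ≤ 0) :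
    ∀ t ∈ Set.Icc 0 T, ∀ x, D t x < 0 := by
  by_contra! hne
  obtain ⟨t0, ht0, x0, hx0⟩ := hne
  obtain ⟨M, hM⟩ := hinf
  let S : Set (ℝ × ℝ) :=
    (Set.Icc 0 T ×ˢ Set.univ) ∩ (fun q : ℝ × ℝ => D q.1 q.2) ⁻¹' (Set.Ici 0)
  have hSc : IsClosed S :=
    hcont.preimage_isClosed_of_isClosed (isClosed_Icc.prod isClosed_univ) isClosed_Ici
  have hSb : S ⊆ Set.Icc 0 T ×ˢ Set.Icc (-M) M := by
    rintro ⟨t, x⟩ ⟨⟨h, -⟩, h'⟩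
    refine ⟨h, abs_le.1 ?_⟩
    by_contra! hlt
    exact (hM t h x hlt).not_ge h'
  have hSk : IsCompact S := (isCompact_Icc.prod isCompact_Icc).of_isClosed_subset hSc hSb
  obtain ⟨⟨t, x⟩, ⟨⟨htI, -⟩, hD⟩, hmax⟩ :=
    hSk.exists_isMaxOn ⟨(t0, x0), ⟨ht0, trivial⟩, hx0⟩ continuous_fst.continuousOn
  simp only [Set.mem_preimage, Set.mem_Ici] at hD
  have htT : t < T := htI.2.lt_of_ne fun h : t = T => (hT x).not_ge (h ▸ hD)
  have hlater : ∀ s ∈ Set.Ioo t T, ∀ y, D s y < 0 := by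
    intro s hs y
    by_contra! hge
    exact hs.1.not_ge (hmax (a := (s, y)) ⟨⟨⟨htI.1.trans hs.1.le, hs.2.le⟩, trivial⟩, hge⟩)
  have htI' : t ∈ Set.Ico 0 T := ⟨htI.1, htT⟩
  have hle : ∀ y, D t y ≤ 0 := by
    intro y
    have : Tendsto (fun s => D s y) (𝓝[>] t) (𝓝 (D t y)) :=
      (ht t htI' y).continuousWithinAt.tendsto.mono_left (nhdsWithin_mono _ Set.Ioi_subset_Ici_self)
    refine le_of_tendsto this ?_
    filter_upwards [Ioo_mem_nhdsGT htT] with s hs using (hlater s hs y).le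
  have hzero : D t x = 0 := le_antisymm (hle x) hD
  have hloc : IsLocalMax (D t) x := Eventually.of_forall fun y => by rw [hzero]; exact hle y
  refine hno t htI' x hzero (hloc.hasDerivAt_eq_zero (h1 t htI' x))
    (hloc.second_deriv_nonpos (h1 t htI') (h2 t htI' x))
    ((ht t htI' x).nonpos_of_le htT fun s hs => ?_)
  rw [hzero]
  exact (hlater s hs x).le

/-- The exponential rate at which the weight `(1 + x²)^p` grows under a diffusion with drift
bounded by `β (1 + |x|)`. -/
def weightRate (β : ℝ) (p : ℕ) : ℝ := p + 2 * p ^ 2 + 4 * p * β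

/-- The first derivative of `(1 + x²)^p`. -/
def weightDeriv (p : ℕ) (x : ℝ) : ℝ := p * (1 + x ^ 2) ^ (p - 1) * (2 * x)

/-- The second derivative of `(1 + x²)^p`. -/
def weightDeriv2 (p : ℕ) (x : ℝ) : ℝ :=
  p * ((p - 1 : ℕ) * (1 + x ^ 2) ^ (p - 1 - 1) * (2 * x)) * (2 * x) + p * (1 + x ^ 2) ^ (p - 1) * 2

lemma hasDerivAt_weight (p : ℕ) (x : ℝ) :
    HasDerivAt (fun x : ℝ => (1 + x ^ 2) ^ p) (weightDeriv p x) x := by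
  have : HasDerivAt (fun x : ℝ => 1 + x ^ 2) (2 * x) x := by
    simpa using (hasDerivAt_pow 2 x).const_add 1
  exact this.pow p

lemma hasDerivAt_weightDeriv (p : ℕ) (x : ℝ) :
    HasDerivAt (weightDeriv p) (weightDeriv2 p x) x := by
  have h2 : HasDerivAt (fun x : ℝ => 2 * x) 2 x := by
    simpa using (hasDerivAt_id x).const_mul 2
  exact ((hasDerivAt_weight (p - 1) x).const_mul (p : ℝ)).mul h2

lemma weight_rate_le {β b : ℝ} (hβ : 0 ≤ β) (p : ℕ) (x : ℝ) (hb : |b| ≤ β * (1 + |x|)) :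
    1 / 2 * weightDeriv2 p x + b * weightDeriv p x ≤ weightRate β p * (1 + x ^ 2) ^ p := by
  rcases p with _ | q
  · simp [weightDeriv2, weightDeriv, weightRate]
  have hW : (1 : ℝ) ≤ 1 + x ^ 2 := by nlinarith [sq_nonneg x]
  have hWq : (0 : ℝ) ≤ (1 + x ^ 2) ^ q := by positivity
  have h1 : (q : ℝ) * ((1 + x ^ 2) ^ (q - 1) * x ^ 2) ≤ q * (1 + x ^ 2) ^ q := by
    rcases q with _ | r
    · simp
    · have : (0 : ℝ) ≤ (1 + x ^ 2) ^ r := by positivity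
      refine mul_le_mul_of_nonneg_left ?_ (Nat.cast_nonneg _)
      rw [Nat.add_sub_cancel, pow_succ]
      exact mul_le_mul_of_nonneg_left (by linarith) this
  have h2 : b * (2 * x) ≤ 4 * β * (1 + x ^ 2) := by
    calc b * (2 * x) ≤ |b * (2 * x)| := le_abs_self _
      _ = |b| * (2 * |x|) := by rw [abs_mul, abs_mul, abs_two]
      _ ≤ β * (1 + |x|) * (2 * |x|) := mul_le_mul_of_nonneg_right hb (by positivity)
      _ = β * (2 * |x| + 2 * x ^ 2) := by rw [← sq_abs x]; ring
      _ ≤ β * (4 * (1 + x ^ 2)) := mul_le_mul_of_nonneg_left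
          (by nlinarith [sq_nonneg (|x| - 1), sq_abs x]) hβ
      _ = _ := by ring
  have h3 : (1 + x ^ 2) ^ q ≤ (1 + x ^ 2) ^ (q + 1) := pow_le_pow_right₀ hW (Nat.le_succ q)
  have e : 1 / 2 * weightDeriv2 (q + 1) x + b * weightDeriv (q + 1) x =
      (q + 1) * (2 * (q * ((1 + x ^ 2) ^ (q - 1) * x ^ 2)) + (1 + x ^ 2) ^ q +
        b * (2 * x) * (1 + x ^ 2) ^ q) := by
    simp only [weightDeriv2, weightDeriv, Nat.add_sub_cancel]
    push_cast
    ring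
  have e' : weightRate β (q + 1 : ℕ) * (1 + x ^ 2) ^ (q + 1) =
      (q + 1) * ((2 * (q + 1) + 1) * (1 + x ^ 2) ^ (q + 1) +
        4 * β * (1 + x ^ 2) * (1 + x ^ 2) ^ q) := by
    rw [weightRate]
    push_cast
    ring
  rw [e, e']
  refine mul_le_mul_of_nonneg_left (add_le_add ?_ (mul_le_mul_of_nonneg_right h2 hWq))
    (by positivity)
  have h4 : (q : ℝ) * (1 + x ^ 2) ^ q ≤ q * (1 + x ^ 2) ^ (q + 1) :=
    mul_le_mul_of_nonneg_left h3 (Nat.cast_nonneg _)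
  nlinarith [hWq.trans h3]

lemma weightRate_nonneg {β : ℝ} (hβ : 0 ≤ β) (p : ℕ) : 0 ≤ weightRate β p := by
  unfold weightRate
  positivity

/-- Subsolutions of a linear backward equation with polynomial growth are controlled by their
source and terminal data. -/
lemma le_of_subsolution {T β A : ℝ} {p : ℕ} {ρ R : ℝ → ℝ} {w w1 w2 wt b c : ℝ → ℝ → ℝ}
    (hT0 : 0 ≤ T) (hβ : 0 ≤ β) (hA : 0 ≤ A)
    (hcont : ContinuousOn (fun q : ℝ × ℝ => w q.1 q.2) (Set.Icc 0 T ×ˢ Set.univ))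
    (hgrow : ∃ C : ℝ, ∃ N : ℕ, ∀ t ∈ Set.Icc 0 T, ∀ x, w t x ≤ C * (1 + x ^ 2) ^ N)
    (h1 : ∀ t ∈ Set.Ico 0 T, ∀ x, HasDerivAt (w t) (w1 t x) x)
    (h2 : ∀ t ∈ Set.Ico 0 T, ∀ x, HasDerivAt (w1 t) (w2 t x) x)
    (ht : ∀ t ∈ Set.Ico 0 T, ∀ x, HasDerivWithinAt (fun t => w t x) (wt t x) (Set.Ici t) t)
    (hb : ∀ t ∈ Set.Ico 0 T, ∀ x, |b t x| ≤ β * (1 + |x|))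
    (hc : ∀ t ∈ Set.Ico 0 T, ∀ x, c t x ≤ 0)
    (hρ : ∀ t ∈ Set.Ico 0 T, 0 ≤ ρ t) (hR0 : ∀ t ∈ Set.Icc 0 T, 0 ≤ R t)
    (hRc : ContinuousOn R (Set.Icc 0 T))
    (hR : ∀ t ∈ Set.Ico 0 T, HasDerivWithinAt R (-ρ t) (Set.Ici t) t)
    (hsub : ∀ t ∈ Set.Ico 0 T, ∀ x, -(ρ t * (1 + x ^ 2) ^ p) ≤
      wt t x + 1 / 2 * w2 t x + b t x * w1 t x + c t x * w t x)
    (hT : ∀ x, w T x ≤ A * (1 + x ^ 2) ^ p) :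
    ∀ t ∈ Set.Icc 0 T, ∀ x,
      w t x ≤ Real.exp (weightRate β p * (T - t)) * (A + R t) * (1 + x ^ 2) ^ p := by
  obtain ⟨C, N, hC⟩ := hgrow
  set l := weightRate β p with hl
  set l' := weightRate β (N + 1) with hl'
  have hl0 : 0 ≤ l := weightRate_nonneg hβ _
  have hl'0 : 0 ≤ l' := weightRate_nonneg hβ _
  have hW : ∀ (n : ℕ) (x : ℝ), 0 < (1 + x ^ 2) ^ n := fun n x => by positivity
  have key : ∀ ε : ℝ, 0 < ε → ∀ t ∈ Set.Icc 0 T, ∀ x,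
      w t x - (Real.exp (l * (T - t)) * (A + R t) * (1 + x ^ 2) ^ p +
        ε * Real.exp ((l' + 1) * (T - t)) * (1 + x ^ 2) ^ (N + 1)) < 0 := by
    intro ε hε
    have hE : ∀ k t : ℝ, HasDerivAt (fun t => Real.exp (k * (T - t)))
        (-k * Real.exp (k * (T - t))) t := by
      intro k t
      have : HasDerivAt (fun t : ℝ => k * (T - t)) (k * (-1)) t :=
        ((hasDerivAt_id t).const_sub T).const_mul k
      exact this.exp.congr_deriv (by ring)
    refine neg_of_no_touching (D1 := fun t x => w1 t x -
        (Real.exp (l * (T - t)) * (A + R t) * weightDeriv p x +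
        ε * Real.exp ((l' + 1) * (T - t)) * weightDeriv (N + 1) x))
      (D2 := fun t x => w2 t x - (Real.exp (l * (T - t)) * (A + R t) * weightDeriv2 p x +
        ε * Real.exp ((l' + 1) * (T - t)) * weightDeriv2 (N + 1) x))
      (Dt := fun t x => wt t x -
        ((-l * Real.exp (l * (T - t)) * (A + R t) + Real.exp (l * (T - t)) * (-ρ t)) *
          (1 + x ^ 2) ^ p +
        ε * (-(l' + 1) * Real.exp ((l' + 1) * (T - t))) * (1 + x ^ 2) ^ (N + 1)))
      ?_ ?_ ?_ ?_ ?_ ?_ ?_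
    · refine hcont.sub ?_
      have hR' : ContinuousOn (fun q : ℝ × ℝ => R q.1) (Set.Icc 0 T ×ˢ Set.univ) :=
        hRc.comp continuousOn_fst fun q hq => hq.1
      have hx : ∀ n : ℕ, Continuous fun q : ℝ × ℝ => (1 + q.2 ^ 2) ^ n := fun n => by fun_prop
      have he : ∀ k : ℝ, Continuous fun q : ℝ × ℝ => Real.exp (k * (T - q.1)) :=
        fun k => by fun_prop
      exact (((he l).continuousOn.mul (hR'.const_add A)).mul (hx p).continuousOn).add
        (((he (l' + 1)).const_mul ε).mul (hx (N + 1))).continuousOn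
    · intro x
      have hp := mul_nonneg (hR0 T ⟨hT0, le_rfl⟩) (hW p x).le
      have hN := mul_pos hε (hW (N + 1) x)
      have := hT x
      simp only [sub_self, mul_zero, Real.exp_zero, one_mul, mul_one]
      linarith
    · refine ⟨|C| / ε + 1, fun t ht x hx => ?_⟩
      have hx1 : 1 ≤ |x| := by
        have : 0 ≤ |C| / ε := by positivity
        linarith
      have hx2 : |C| < ε * (1 + x ^ 2) := by
        have : |C| / ε < 1 + x ^ 2 := by nlinarith [sq_abs x]
        rwa [div_lt_iff₀' hε] at this
      have hE2 : 1 ≤ Real.exp ((l' + 1) * (T - t)) :=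
        Real.one_le_exp (mul_nonneg (by linarith) (sub_nonneg.2 ht.2))
      have hB1 : 0 ≤ Real.exp (l * (T - t)) * (A + R t) * (1 + x ^ 2) ^ p :=
        mul_nonneg (mul_nonneg (Real.exp_pos _).le (add_nonneg hA (hR0 t ht))) (hW p x).le
      have h3 : C * (1 + x ^ 2) ^ N < ε * (1 + x ^ 2) ^ (N + 1) := by
        rw [pow_succ' (1 + x ^ 2) N, ← mul_assoc]
        nlinarith [mul_lt_mul_of_pos_right ((le_abs_self C).trans_lt hx2) (hW N x)]
      have h4 : ε * (1 + x ^ 2) ^ (N + 1) ≤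
          ε * Real.exp ((l' + 1) * (T - t)) * (1 + x ^ 2) ^ (N + 1) :=
        mul_le_mul_of_nonneg_right (le_mul_of_one_le_right hε.le hE2) (hW _ x).le
      linarith [hC t ht x]
    · exact fun t ht x => (h1 t ht x).sub (((hasDerivAt_weight p x).const_mul _).add
        ((hasDerivAt_weight (N + 1) x).const_mul _))
    · exact fun t ht x => (h2 t ht x).sub (((hasDerivAt_weightDeriv p x).const_mul _).add
        ((hasDerivAt_weightDeriv (N + 1) x).const_mul _))
    · intro t h x
      exact (ht t h x).sub ((((hE l t).hasDerivWithinAt.mul ((hR t h).const_add A)).mul_const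
        ((1 + x ^ 2) ^ p)).add (((hE (l' + 1) t).hasDerivWithinAt.const_mul ε).mul_const _))
    · intro t h x h0 hd1 hd2 hdt
      have htI : t ∈ Set.Icc 0 T := ⟨h.1, h.2.le⟩
      have hs := hsub t h x
      have hr1 := mul_le_mul_of_nonneg_left (weight_rate_le hβ p x (hb t h x))
        (mul_nonneg (Real.exp_pos (l * (T - t))).le (add_nonneg hA (hR0 t htI)))
      have hr2 := mul_le_mul_of_nonneg_left (weight_rate_le hβ (N + 1) x (hb t h x))
        (mul_pos hε (Real.exp_pos ((l' + 1) * (T - t)))).le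
      rw [← hl] at hr1
      rw [← hl'] at hr2
      have hE1 : 1 ≤ Real.exp (l * (T - t)) :=
        Real.one_le_exp (mul_nonneg hl0 (sub_nonneg.2 h.2.le))
      have hB1 : 0 ≤ Real.exp (l * (T - t)) * (A + R t) * (1 + x ^ 2) ^ p :=
        mul_nonneg (mul_nonneg (Real.exp_pos _).le (add_nonneg hA (hR0 t htI))) (hW p x).le
      have hB2 : 0 < ε * Real.exp ((l' + 1) * (T - t)) * (1 + x ^ 2) ^ (N + 1) :=
        mul_pos (mul_pos hε (Real.exp_pos _)) (hW _ x)
      have hcw : c t x * w t x ≤ 0 :=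
        mul_nonpos_of_nonpos_of_nonneg (hc t h x) (by linarith)
      have hρE : ρ t * (1 + x ^ 2) ^ p ≤ Real.exp (l * (T - t)) * ρ t * (1 + x ^ 2) ^ p :=
        mul_le_mul_of_nonneg_right (le_mul_of_one_le_left (hρ t h) hE1) (hW p x).le
      have hd1' := sub_eq_zero.1 hd1
      rw [hd1'] at hs
      linarith
  intro t h x
  refine le_of_forall_pos_lt_add fun δ hδ => ?_
  have hB := mul_pos (Real.exp_pos ((l' + 1) * (T - t))) (hW (N + 1) x)
  have := key (δ / (Real.exp ((l' + 1) * (T - t)) * (1 + x ^ 2) ^ (N + 1))) (div_pos hδ hB) t h x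
  rw [mul_assoc (δ / _), div_mul_cancel₀ _ hB.ne'] at this
  linarith

lemma abs_le_of_parabolic {T β A r : ℝ} {p : ℕ} {ρ R : ℝ → ℝ} {w w1 w2 wt b c : ℝ → ℝ → ℝ}
    (hT0 : 0 ≤ T) (hT1 : T ≤ 1) (hβ : 0 ≤ β) (hA : 0 ≤ A)
    (hcont : ContinuousOn (fun q : ℝ × ℝ => w q.1 q.2) (Set.Icc 0 T ×ˢ Set.univ))
    (hgrow : ∃ C : ℝ, ∃ N : ℕ, ∀ t ∈ Set.Icc 0 T, ∀ x, |w t x| ≤ C * (1 + x ^ 2) ^ N)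
    (h1 : ∀ t ∈ Set.Ico 0 T, ∀ x, HasDerivAt (w t) (w1 t x) x)
    (h2 : ∀ t ∈ Set.Ico 0 T, ∀ x, HasDerivAt (w1 t) (w2 t x) x)
    (ht : ∀ t ∈ Set.Ico 0 T, ∀ x, HasDerivWithinAt (fun t => w t x) (wt t x) (Set.Ici t) t)
    (hb : ∀ t ∈ Set.Ico 0 T, ∀ x, |b t x| ≤ β * (1 + |x|))
    (hc : ∀ t ∈ Set.Ico 0 T, ∀ x, c t x ≤ 0)
    (hρ : ∀ t ∈ Set.Ico 0 T, 0 ≤ ρ t) (hR0 : ∀ t ∈ Set.Icc 0 T, 0 ≤ R t ∧ R t ≤ r)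
    (hRc : ContinuousOn R (Set.Icc 0 T))
    (hR : ∀ t ∈ Set.Ico 0 T, HasDerivWithinAt R (-ρ t) (Set.Ici t) t)
    (heq : ∀ t ∈ Set.Ico 0 T, ∀ x,
      |wt t x + 1 / 2 * w2 t x + b t x * w1 t x + c t x * w t x| ≤ ρ t * (1 + x ^ 2) ^ p)
    (hT : ∀ x, |w T x| ≤ A * (1 + x ^ 2) ^ p) :
    ∀ t ∈ Set.Icc 0 T, ∀ x, |w t x| ≤ Real.exp (weightRate β p) * (A + r) * (1 + x ^ 2) ^ p := by
  obtain ⟨C, N, hC⟩ := hgrow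
  intro t htI x
  have hle : Real.exp (weightRate β p * (T - t)) * (A + R t) * (1 + x ^ 2) ^ p ≤
      Real.exp (weightRate β p) * (A + r) * (1 + x ^ 2) ^ p := by
    have h0 := hR0 t htI
    gcongr
    · exact add_nonneg hA h0.1
    · exact mul_le_of_le_one_right (weightRate_nonneg hβ p) (by linarith [htI.1])
    · exact h0.2
  refine abs_le.2 ⟨?_, ?_⟩
  · have := le_of_subsolution (w := fun t x => -w t x) (w1 := fun t x => -w1 t x)
      (w2 := fun t x => -w2 t x) (wt := fun t x => -wt t x) hT0 hβ hA hcont.neg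
      ⟨C, N, fun t ht x => (neg_le_abs _).trans (hC t ht x)⟩
      (fun t ht x => (h1 t ht x).neg) (fun t ht x => (h2 t ht x).neg)
      (fun t h x => (ht t h x).neg) hb hc hρ (fun t ht => (hR0 t ht).1) hRc hR
      (fun t ht x => by linarith [(abs_le.1 (heq t ht x)).2])
      (fun x => (neg_le_abs _).trans (hT x)) t htI x
    linarith
  · exact (le_of_subsolution hT0 hβ hA hcont
      ⟨C, N, fun t ht x => (le_abs_self _).trans (hC t ht x)⟩ h1 h2 ht hb hc hρ
      (fun t ht => (hR0 t ht).1) hRc hR (fun t ht x => (abs_le.1 (heq t ht x)).1)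
      (fun x => (le_abs_self _).trans (hT x)) t htI x).trans hle

lemma abs_le_of_parabolic_const {T β A r : ℝ} {p : ℕ} {w w1 w2 wt b c : ℝ → ℝ → ℝ}
    (hT0 : 0 ≤ T) (hT1 : T ≤ 1) (hβ : 0 ≤ β) (hA : 0 ≤ A) (hr : 0 ≤ r)
    (hcont : ContinuousOn (fun q : ℝ × ℝ => w q.1 q.2) (Set.Icc 0 T ×ˢ Set.univ))
    (hgrow : ∃ C : ℝ, ∃ N : ℕ, ∀ t ∈ Set.Icc 0 T, ∀ x, |w t x| ≤ C * (1 + x ^ 2) ^ N)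
    (h1 : ∀ t ∈ Set.Ico 0 T, ∀ x, HasDerivAt (w t) (w1 t x) x)
    (h2 : ∀ t ∈ Set.Ico 0 T, ∀ x, HasDerivAt (w1 t) (w2 t x) x)
    (ht : ∀ t ∈ Set.Ico 0 T, ∀ x, HasDerivWithinAt (fun t => w t x) (wt t x) (Set.Ici t) t)
    (hb : ∀ t ∈ Set.Ico 0 T, ∀ x, |b t x| ≤ β * (1 + |x|))
    (hc : ∀ t ∈ Set.Ico 0 T, ∀ x, c t x ≤ 0)
    (heq : ∀ t ∈ Set.Ico 0 T, ∀ x,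
      |wt t x + 1 / 2 * w2 t x + b t x * w1 t x + c t x * w t x| ≤ r * (1 + x ^ 2) ^ p)
    (hT : ∀ x, |w T x| ≤ A * (1 + x ^ 2) ^ p) :
    ∀ t ∈ Set.Icc 0 T, ∀ x, |w t x| ≤ Real.exp (weightRate β p) * (A + r) * (1 + x ^ 2) ^ p := by
  refine abs_le_of_parabolic (ρ := fun _ => r) (R := fun t => r * (T - t)) hT0 hT1 hβ hA hcont
    hgrow h1 h2 ht hb hc (fun _ _ => hr) (fun t ht => ?_) (by fun_prop) (fun t _ => ?_) heq hT
  · exact ⟨mul_nonneg hr (sub_nonneg.2 ht.2),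
      mul_le_of_le_one_right hr (by linarith [ht.1])⟩
  · exact ((((hasDerivAt_id t).const_sub T).const_mul r).congr_deriv (by ring)).hasDerivWithinAt

/-! ### Families with a common polynomial bound -/

/-- A family of functions bounded by a common polynomial times a scale depending on the index. -/
def ScaledPolyB {ι : Type*} (s : ι → ℝ) (F : ι → ℝ → ℝ) : Prop :=
  ∃ C : ℝ, ∃ p : ℕ, 0 ≤ C ∧ ∀ i x, |F i x| ≤ C * s i * (1 + x ^ 2) ^ p

namespace ScaledPolyB

variable {ι : Type*} {s r : ι → ℝ} {F G : ι → ℝ → ℝ}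

lemma add (hs : ∀ i, 0 ≤ s i) (hF : ScaledPolyB s F) (hG : ScaledPolyB s G) :
    ScaledPolyB s fun i x => F i x + G i x := by
  obtain ⟨C, p, hC, hF⟩ := hF
  obtain ⟨D, q, hD, hG⟩ := hG
  refine ⟨C + D, max p q, add_nonneg hC hD, fun i x => (abs_add_le _ _).trans ?_⟩
  have h1 := mul_le_mul_of_nonneg_left (weight_mono (le_max_left p q) x) (mul_nonneg hC (hs i))
  have h2 := mul_le_mul_of_nonneg_left (weight_mono (le_max_right p q) x) (mul_nonneg hD (hs i))
  linarith [hF i x, hG i x]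

lemma mul (hs : ∀ i, 0 ≤ s i) (hF : ScaledPolyB s F) (hG : ScaledPolyB r G) :
    ScaledPolyB (fun i => s i * r i) fun i x => F i x * G i x := by
  obtain ⟨C, p, hC, hF⟩ := hF
  obtain ⟨D, q, hD, hG⟩ := hG
  refine ⟨C * D, p + q, mul_nonneg hC hD, fun i x => ?_⟩
  rw [abs_mul]
  calc |F i x| * |G i x| ≤ (C * s i * (1 + x ^ 2) ^ p) * (D * r i * (1 + x ^ 2) ^ q) :=
        mul_le_mul (hF i x) (hG i x) (abs_nonneg _)
          (mul_nonneg (mul_nonneg hC (hs i)) (by positivity))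
    _ = _ := by ring

lemma const_mul (c : ℝ) (hF : ScaledPolyB s F) :
    ScaledPolyB s fun i x => c * F i x := by
  obtain ⟨C, p, hC, hF⟩ := hF
  refine ⟨|c| * C, p, by positivity, fun i x => ?_⟩
  rw [abs_mul]
  calc |c| * |F i x| ≤ |c| * (C * s i * (1 + x ^ 2) ^ p) :=
        mul_le_mul_of_nonneg_left (hF i x) (abs_nonneg c)
    _ = _ := by ring

lemma sum (hs : ∀ i, 0 ≤ s i) {κ : Type*} (S : Finset κ) {F : κ → ι → ℝ → ℝ}
    (hF : ∀ j ∈ S, ScaledPolyB s (F j)) : ScaledPolyB s fun i x => ∑ j ∈ S, F j i x := by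
  classical
  induction S using Finset.induction_on with
  | empty => exact ⟨0, 0, le_rfl, by simp⟩
  | insert a S ha ih =>
    simp only [Finset.sum_insert ha]
    exact (hF a (Finset.mem_insert_self a S)).add hs
      (ih fun j hj => hF j (Finset.mem_insert_of_mem hj))

lemma comp {ι' : Type*} (f : ι' → ι) (hF : ScaledPolyB s F) :
    ScaledPolyB (fun i => s (f i)) fun i => F (f i) := by
  obtain ⟨C, p, hC, hF⟩ := hF
  exact ⟨C, p, hC, fun i => hF (f i)⟩

end ScaledPolyB

/-! ### Leibniz expansions -/

lemma iteratedDeriv_mul_eq_first_two {f g : ℝ → ℝ} (hf : ContDiff ℝ ∞ f) (hg : ContDiff ℝ ∞ g)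
    (k : ℕ) (x : ℝ) :
    iteratedDeriv k (fun y => f y * g y) x = f x * iteratedDeriv k g x +
      k * deriv f x * iteratedDeriv (k - 1) g x +
      ∑ i ∈ Finset.range (k - 1),
        (k.choose (i + 2) : ℝ) * (iteratedDeriv (i + 2) f x * iteratedDeriv (k - (i + 2)) g x) := by
  have := iteratedDeriv_mul (n := k) (x := x) (hf.of_le (by exact_mod_cast le_top)).contDiffAt
    (hg.of_le (by exact_mod_cast le_top)).contDiffAt
  rw [show (fun y => f y * g y) = f * g from rfl, this]
  rcases k with _ | k
  · simp
  · rw [Finset.sum_range_succ', Finset.sum_range_succ']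
    simp [mul_assoc]
    ring

lemma iteratedDeriv_sq_expansion {f : ℝ → ℝ} (hf : ContDiff ℝ ∞ f) (l : ℕ) (x : ℝ) :
    iteratedDeriv (l + 3) (fun y => f y * f y) x =
      2 * (f x * iteratedDeriv (l + 3) f x + (l + 3) * deriv f x * iteratedDeriv (l + 2) f x +
      ∑ i ∈ Finset.range l, ((l + 2).choose (i + 2) : ℝ) *
        (iteratedDeriv (i + 2) f x * iteratedDeriv (l - i + 1) f x)) := by
  have hf' : ContDiff ℝ ∞ (deriv f) := (contDiff_infty_iff_deriv.1 hf).2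
  have hd : deriv (fun y => f y * f y) = fun y => 2 * (f y * deriv f y) := by
    ext y
    have h := (hf.differentiable (by simp) y).hasDerivAt
    exact (h.mul h).deriv.trans (by ring)
  rw [iteratedDeriv_succ', hd, iteratedDeriv_const_mul_field, iteratedDeriv_mul_eq_first_two hf hf',
    show l + 2 - 1 = l + 1 from rfl, Finset.sum_range_succ]
  simp only [← iteratedDeriv_succ']
  have e : ∀ i ∈ Finset.range l, ((l + 2).choose (i + 2) : ℝ) *
      (iteratedDeriv (i + 2) f x * iteratedDeriv (l + 2 - (i + 2) + 1) f x) =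
      ((l + 2).choose (i + 2) : ℝ) *
        (iteratedDeriv (i + 2) f x * iteratedDeriv (l - i + 1) f x) := by
    intro i _
    rw [Nat.add_sub_add_right]
  rw [Finset.sum_congr rfl e]
  simp
  ring

/-- A smooth concave solution on `[0, T]` of the Parisi equation with terminal value `g`. -/
structure ParisiFlow (g : ℝ → ℝ) (C T : ℝ) where
  φ : ℝ → ℝ → ℝ
  m : ℝ → ℝ
  sol : ParisiSol φ m 0 T
  concave : ∀ t ∈ Set.Icc 0 T, ConcaveData C (φ t)
  terminal : φ T = g
  m_nonneg : ∀ t, 0 ≤ m t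
  m_le_one : ∀ t, m t ≤ 1
  m_mono : Monotone m
  m_right : ∀ t, ContinuousWithinAt m (Set.Ici t) t

namespace ParisiFlow

variable {g : ℝ → ℝ} {C T : ℝ}

lemma hasDerivAt (P : ParisiFlow g C T) (k : ℕ) {t : ℝ} (ht : t ∈ Set.Icc 0 T) (x : ℝ) :
    HasDerivAt (iteratedDeriv k (P.φ t)) (iteratedDeriv (k + 1) (P.φ t) x) x := by
  rw [iteratedDeriv_succ]
  exact ((P.sol.smooth t ht).differentiable_iteratedDeriv k
    (by exact_mod_cast WithTop.coe_lt_top _) x).hasDerivAt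

lemma contDiff_deriv (P : ParisiFlow g C T) {t : ℝ} (ht : t ∈ Set.Icc 0 T) :
    ContDiff ℝ ∞ (deriv (P.φ t)) :=
  (contDiff_infty_iff_deriv.1 (P.sol.smooth t ht)).2

lemma iteratedDeriv_two_nonpos (P : ParisiFlow g C T) {t : ℝ} (ht : t ∈ Set.Icc 0 T) (x : ℝ) :
    iteratedDeriv 2 (P.φ t) x ≤ 0 := by
  rw [iteratedDeriv_succ, iteratedDeriv_one]
  exact (P.concave t ht).deriv2_nonpos x

lemma abs_iteratedDeriv_two_le (P : ParisiFlow g C T) {t : ℝ} (ht : t ∈ Set.Icc 0 T) (x : ℝ) :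
    |iteratedDeriv 2 (P.φ t) x| ≤ C := by
  rw [iteratedDeriv_succ, iteratedDeriv_one]
  have h1 := (P.concave t ht).deriv2_nonpos x
  have h2 := (P.concave t ht).le_deriv2 x
  exact abs_le.2 ⟨h2, h1.trans (by linarith)⟩

/-- The space derivatives of all flows with the same terminal value grow at most linearly,
with common constants. -/
lemma exists_abs_deriv_le (hg : g.HasTemperateGrowth) (hT0 : 0 ≤ T) (hT1 : T ≤ 1) (hC : 0 ≤ C) :
    ∃ β : ℝ, 0 ≤ β ∧ ∀ (P : ParisiFlow g C T), ∀ t ∈ Set.Icc 0 T, ∀ x,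
      |deriv (P.φ t) x| ≤ β * (1 + |x|) := by
  obtain ⟨A, p, hA, hb⟩ := (hasTemperateGrowth_iff_polyB.1 hg).2 1
  have key : ∀ (P : ParisiFlow g C T), ∀ t ∈ Set.Icc 0 T, ∀ x,
      |iteratedDeriv 1 (P.φ t) x| ≤ Real.exp (weightRate 0 p) * (A + 0) * (1 + x ^ 2) ^ p := by
    intro P
    obtain ⟨B, N, -, hB⟩ := P.sol.growth 1
    refine abs_le_of_parabolic_const (b := fun _ _ => 0)
      (c := fun t x => P.m t * iteratedDeriv 2 (P.φ t) x) hT0 hT1 le_rfl hA le_rfl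
      (P.sol.cont 1) ⟨B, N, hB⟩ (fun t ht x => P.hasDerivAt 1 (Set.Ico_subset_Icc_self ht) x)
      (fun t ht x => P.hasDerivAt 2 (Set.Ico_subset_Icc_self ht) x) (P.sol.evol 1)
      (fun _ _ _ => by simp) (fun t ht x => mul_nonpos_of_nonneg_of_nonpos (P.m_nonneg t)
        (P.iteratedDeriv_two_nonpos (Set.Ico_subset_Icc_self ht) x)) (fun t ht x => ?_)
      (fun x => by rw [P.terminal]; exact hb x)
    have hf := P.contDiff_deriv (Set.Ico_subset_Icc_self ht)
    have e : iteratedDeriv 1 (fun y => deriv (P.φ t) y * deriv (P.φ t) y) x =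
        2 * (iteratedDeriv 2 (P.φ t) x * iteratedDeriv 1 (P.φ t) x) := by
      rw [iteratedDeriv_mul_eq_first_two hf hf, iteratedDeriv_succ (n := 1)]
      simp only [iteratedDeriv_one]
      simp
      ring
    rw [e]
    refine le_of_eq_of_le ?_ (by positivity : (0 : ℝ) ≤ 0 * (1 + x ^ 2) ^ p)
    rw [abs_eq_zero]
    ring
  set M := Real.exp (weightRate 0 p) * (A + 0) with hM
  have hM0 : 0 ≤ M := by positivity
  refine ⟨M + C, by positivity, fun P t ht x => ?_⟩
  have h0 : |deriv (P.φ t) 0| ≤ M := by simpa using key P t ht 0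
  have h1 : |deriv (P.φ t) x - deriv (P.φ t) 0| ≤ C * |x - 0| := by
    refine Convex.norm_image_sub_le_of_norm_hasDerivWithin_le (s := Set.univ)
      (f' := iteratedDeriv 2 (P.φ t)) (fun y _ => ?_)
      (fun y _ => P.abs_iteratedDeriv_two_le ht y) convex_univ trivial trivial
    simpa only [iteratedDeriv_one] using (P.hasDerivAt 1 ht y).hasDerivWithinAt
  rw [sub_zero] at h1
  have h2 : |deriv (P.φ t) x| ≤ |deriv (P.φ t) x - deriv (P.φ t) 0| + |deriv (P.φ t) 0| := by
    simpa using abs_add_le (deriv (P.φ t) x - deriv (P.φ t) 0) (deriv (P.φ t) 0)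
  nlinarith [mul_nonneg hM0 (abs_nonneg x)]

/-- All space derivatives of order at least one are bounded by polynomials, uniformly over the
flows with the same terminal value. -/
lemma scaledPolyB_iteratedDeriv (hg : g.HasTemperateGrowth) (hT0 : 0 ≤ T) (hT1 : T ≤ 1)
    (hC : 0 ≤ C) (k : ℕ) :
    ScaledPolyB (fun _ : ParisiFlow g C T × Set.Icc 0 T => 1)
      fun i => iteratedDeriv k (deriv (i.1.φ i.2)) := by
  obtain ⟨β, hβ, hlin⟩ := exists_abs_deriv_le hg hT0 hT1 hC
  have h01 : ∀ _ : ParisiFlow g C T × Set.Icc 0 T, (0 : ℝ) ≤ 1 := fun _ => zero_le_one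
  induction k using Nat.strong_induction_on with
  | _ k ih =>
  match k, ih with
  | 0, _ =>
    refine ⟨2 * β, 1, by positivity, fun i x => ?_⟩
    simp only [iteratedDeriv_zero]
    refine (hlin i.1 i.2 i.2.2 x).trans ?_
    nlinarith [sq_nonneg (|x| - 1), sq_abs x]
  | 1, _ =>
    refine ⟨C, 0, hC, fun i x => ?_⟩
    simp only [← iteratedDeriv_succ']
    simpa using i.1.abs_iteratedDeriv_two_le i.2.2 x
  | l + 2, ih =>
    have hrest : ScaledPolyB (fun _ : ParisiFlow g C T × Set.Icc 0 T => 1) fun i x =>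
        ∑ j ∈ Finset.range l, ((l + 2).choose (j + 2) : ℝ) *
          (iteratedDeriv (j + 2) (deriv (i.1.φ i.2)) x *
            iteratedDeriv (l - j + 1) (deriv (i.1.φ i.2)) x) := by
      refine ScaledPolyB.sum h01 _ fun j hj => ScaledPolyB.const_mul _ ?_
      have hj := Finset.mem_range.1 hj
      simpa using (ih (j + 2) (by omega)).mul h01 (ih (l - j + 1) (by omega))
    obtain ⟨r, q, hr, hrb⟩ := hrest
    obtain ⟨A, p, hA, hb⟩ := (hasTemperateGrowth_iff_polyB.1 hg).2 (l + 3)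
    refine ⟨Real.exp (weightRate β (max p q)) * (A + r), max p q, by positivity, ?_⟩
    rintro ⟨P, t, htI⟩ x
    simp only [← iteratedDeriv_succ', mul_one]
    obtain ⟨B, N, -, hB⟩ := P.sol.growth (l + 3)
    refine abs_le_of_parabolic_const (b := fun t x => P.m t * deriv (P.φ t) x)
      (c := fun t x => P.m t * ((l + 3) * iteratedDeriv 2 (P.φ t) x)) hT0 hT1 hβ hA hr
      (P.sol.cont (l + 3)) ⟨B, N, hB⟩
      (fun t ht x => P.hasDerivAt (l + 3) (Set.Ico_subset_Icc_self ht) x)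
      (fun t ht x => P.hasDerivAt (l + 4) (Set.Ico_subset_Icc_self ht) x) (P.sol.evol (l + 3))
      (fun t ht x => ?_) (fun t ht x => ?_) (fun t ht x => ?_) (fun x => ?_) t htI x
    · rw [abs_mul, abs_of_nonneg (P.m_nonneg t)]
      exact (mul_le_of_le_one_left (abs_nonneg _) (P.m_le_one t)).trans
        (hlin P t (Set.Ico_subset_Icc_self ht) x)
    · exact mul_nonpos_of_nonneg_of_nonpos (P.m_nonneg t) (mul_nonpos_of_nonneg_of_nonpos
        (by positivity) (P.iteratedDeriv_two_nonpos (Set.Ico_subset_Icc_self ht) x))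
    · have ht' := Set.Ico_subset_Icc_self ht
      rw [iteratedDeriv_sq_expansion (P.contDiff_deriv ht')]
      have hb := (hrb (P, ⟨t, ht'⟩) x).trans (mul_le_mul_of_nonneg_left
        (weight_mono (le_max_right p q) x) (by rwa [mul_one]))
      simp only [mul_one] at hb
      refine le_trans ?_ ((mul_le_of_le_one_left (abs_nonneg _) (P.m_le_one t)).trans hb)
      generalize ∑ j ∈ Finset.range l, ((l + 2).choose (j + 2) : ℝ) *
          (iteratedDeriv (j + 2) (deriv (P.φ t)) x *
            iteratedDeriv (l - j + 1) (deriv (P.φ t)) x) = S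
      refine (le_of_eq (congrArg abs (?_ : _ = -(P.m t * S)))).trans (le_of_eq ?_)
      · rw [← iteratedDeriv_succ', ← iteratedDeriv_succ', ← iteratedDeriv_one,
          ← iteratedDeriv_succ]
        ring
      · rw [abs_neg, abs_mul, abs_of_nonneg (P.m_nonneg t)]
    · rw [P.terminal]
      exact (hb x).trans (mul_le_mul_of_nonneg_left (weight_mono (le_max_left p q) x) hA)

end ParisiFlow

/-! ### Stability of the flows with respect to the order parameter -/

lemma iteratedDeriv_sq_sub_sq {f g : ℝ → ℝ} (hf : ContDiff ℝ ∞ f) (hg : ContDiff ℝ ∞ g)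
    (k : ℕ) (x : ℝ) :
    iteratedDeriv k (fun y => f y * f y) x - iteratedDeriv k (fun y => g y * g y) x =
      (f x + g x) * (iteratedDeriv k f x - iteratedDeriv k g x) +
      k * (deriv f x + deriv g x) * (iteratedDeriv (k - 1) f x - iteratedDeriv (k - 1) g x) +
      ∑ i ∈ Finset.range (k - 1), (k.choose (i + 2) : ℝ) *
        ((iteratedDeriv (i + 2) f x + iteratedDeriv (i + 2) g x) *
          (iteratedDeriv (k - (i + 2)) f x - iteratedDeriv (k - (i + 2)) g x)) := by
  have hn : ∀ {h : ℝ → ℝ}, ContDiff ℝ ∞ h → ∀ n : ℕ, ContDiffAt ℝ n h x := fun hh n =>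
    (hh.of_le (by exact_mod_cast le_top)).contDiffAt
  have hadd : ∀ n, iteratedDeriv n (f + g) x = iteratedDeriv n f x + iteratedDeriv n g x :=
    fun n => iteratedDeriv_add (hn hf n) (hn hg n)
  have hsub : ∀ n, iteratedDeriv n (f - g) x = iteratedDeriv n f x - iteratedDeriv n g x :=
    fun n => iteratedDeriv_sub (hn hf n) (hn hg n)
  have h1 := iteratedDeriv_mul_eq_first_two (hf.add hg) (hf.sub hg) k x
  have h2 : (fun y => (f + g) y * (f - g) y) =
      (fun y => f y * f y) - fun y => g y * g y := by
    ext y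
    simp only [Pi.add_apply, Pi.sub_apply]
    ring
  have h3 : deriv (f + g) x = deriv f x + deriv g x := by
    simpa only [iteratedDeriv_one] using hadd 1
  change iteratedDeriv k (fun y => (f + g) y * (f - g) y) x = (f + g) x * iteratedDeriv k (f - g) x +
    k * deriv (f + g) x * iteratedDeriv (k - 1) (f - g) x + ∑ i ∈ Finset.range (k - 1),
      (k.choose (i + 2) : ℝ) *
        (iteratedDeriv (i + 2) (f + g) x * iteratedDeriv (k - (i + 2)) (f - g) x) at h1
  rw [h2, iteratedDeriv_sub (hn (hf.mul hf) k) (hn (hg.mul hg) k), h3] at h1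
  simpa only [hadd, hsub, Pi.add_apply] using h1

namespace ParisiFlow

variable {g : ℝ → ℝ} {C T : ℝ}

/-- The distance between the order parameters of two flows. -/
noncomputable def gap (P Q : ParisiFlow g C T) : ℝ := ∫ s in (0 : ℝ)..T, |P.m s - Q.m s|

lemma intervalIntegrable_abs_sub (P Q : ParisiFlow g C T) (a b : ℝ) :
    IntervalIntegrable (fun s => |P.m s - Q.m s|) volume a b :=
  (P.m_mono.intervalIntegrable.sub Q.m_mono.intervalIntegrable).abs

lemma gap_nonneg (hT0 : 0 ≤ T) (P Q : ParisiFlow g C T) : 0 ≤ gap P Q :=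
  intervalIntegral.integral_nonneg hT0 fun _ _ => abs_nonneg _

lemma integral_abs_sub_mem (P Q : ParisiFlow g C T) {t : ℝ} (ht : t ∈ Set.Icc 0 T) :
    ∫ s in t..T, |P.m s - Q.m s| ∈ Set.Icc 0 (gap P Q) :=
  ⟨intervalIntegral.integral_nonneg ht.2 fun _ _ => abs_nonneg _,
    intervalIntegral.integral_mono_interval ht.1 ht.2 le_rfl
      (Eventually.of_forall fun _ => abs_nonneg _) (P.intervalIntegrable_abs_sub Q 0 T)⟩

lemma hasDerivWithinAt_integral_abs_sub (P Q : ParisiFlow g C T) (t : ℝ) :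
    HasDerivWithinAt (fun u => ∫ s in u..T, |P.m s - Q.m s|) (-|P.m t - Q.m t|) (Set.Ici t) t := by
  refine intervalIntegral.integral_hasDerivWithinAt_left (t := Set.Ioi t)
    (P.intervalIntegrable_abs_sub Q t T) ?_ ?_
  · exact (StronglyMeasurable.stronglyMeasurableAtFilter
      (P.m_mono.measurable.sub Q.m_mono.measurable).abs.stronglyMeasurable)
  · exact ((P.m_right t).sub (Q.m_right t)).abs.mono Set.Ioi_subset_Ici_self

/-- The space derivatives of a flow depend Lipschitz continuously on the order parameter,
uniformly over all flows with the same terminal value. -/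
lemma scaledPolyB_sub (hg : g.HasTemperateGrowth) (hT0 : 0 ≤ T) (hT1 : T ≤ 1)
    (hC : 0 ≤ C) (k : ℕ) :
    ScaledPolyB (fun i : (ParisiFlow g C T × ParisiFlow g C T) × Set.Icc 0 T => gap i.1.1 i.1.2)
      fun i x => iteratedDeriv k (i.1.1.φ i.2) x - iteratedDeriv k (i.1.2.φ i.2) x := by
  obtain ⟨β, hβ, hlin⟩ := exists_abs_deriv_le hg hT0 hT1 hC
  have h01 : ∀ _ : (ParisiFlow g C T × ParisiFlow g C T) × Set.Icc 0 T, (0 : ℝ) ≤ 1 :=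
    fun _ => zero_le_one
  have hgap : ∀ i : (ParisiFlow g C T × ParisiFlow g C T) × Set.Icc 0 T, 0 ≤ gap i.1.1 i.1.2 :=
    fun i => gap_nonneg hT0 _ _
  have hU1 := fun n => (scaledPolyB_iteratedDeriv hg hT0 hT1 hC n).comp
    fun i : (ParisiFlow g C T × ParisiFlow g C T) × Set.Icc 0 T => (i.1.1, i.2)
  have hU2 := fun n => (scaledPolyB_iteratedDeriv hg hT0 hT1 hC n).comp
    fun i : (ParisiFlow g C T × ParisiFlow g C T) × Set.Icc 0 T => (i.1.2, i.2)
  induction k using Nat.strong_induction_on with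
  | _ k ih =>
  obtain ⟨C1, p1, hC1, hrest⟩ : ScaledPolyB
      (fun i : (ParisiFlow g C T × ParisiFlow g C T) × Set.Icc 0 T => gap i.1.1 i.1.2)
      fun i x => ∑ j ∈ Finset.range (k - 1), (k.choose (j + 2) : ℝ) *
        ((iteratedDeriv (j + 2) (deriv (i.1.1.φ i.2)) x +
            iteratedDeriv (j + 2) (deriv (i.1.2.φ i.2)) x) *
          (iteratedDeriv (k - (j + 2)) (deriv (i.1.1.φ i.2)) x -
            iteratedDeriv (k - (j + 2)) (deriv (i.1.2.φ i.2)) x)) := by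
    refine ScaledPolyB.sum hgap _ fun j hj => ScaledPolyB.const_mul _ ?_
    have hj := Finset.mem_range.1 hj
    simp only [← iteratedDeriv_succ' (n := k - (j + 2))]
    simpa only [one_mul] using
      ((hU1 (j + 2)).add h01 (hU2 (j + 2))).mul h01 (ih (k - (j + 2) + 1) (by omega))
  obtain ⟨C2, p2, hC2, hsq⟩ : ScaledPolyB
      (fun _ : (ParisiFlow g C T × ParisiFlow g C T) × Set.Icc 0 T => 1)
      fun i x => iteratedDeriv k (fun y => deriv (i.1.2.φ i.2) y * deriv (i.1.2.φ i.2) y) x := by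
    have hmul := fun n l => ((hU2 n).mul h01 (hU2 l))
    simp only [mul_one] at hmul
    have e := fun (i : (ParisiFlow g C T × ParisiFlow g C T) × Set.Icc 0 T) (x : ℝ) =>
      iteratedDeriv_mul_eq_first_two (i.1.2.contDiff_deriv i.2.2) (i.1.2.contDiff_deriv i.2.2) k x
    simp only [e]
    refine ((hmul 0 k).add h01 ?_).add h01
      (ScaledPolyB.sum h01 _ fun j _ => (hmul (j + 2) (k - (j + 2))).const_mul _)
    simpa only [mul_assoc, iteratedDeriv_one] using (hmul 1 (k - 1)).const_mul (k : ℝ)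
  refine ⟨Real.exp (weightRate β (max p1 p2)) * ((C1 + C2) * 2), max p1 p2, by positivity, ?_⟩
  rintro ⟨⟨P, Q⟩, t, htI⟩ x
  have hPQ := gap_nonneg hT0 P Q
  have hgoal : Real.exp (weightRate β (max p1 p2)) * ((C1 + C2) * 2) * gap P Q =
    Real.exp (weightRate β (max p1 p2)) * (0 + (C1 + C2) * (gap P Q + gap P Q)) := by ring
  simp only [hgoal]
  obtain ⟨B1, N1, hB1, hg1⟩ := P.sol.growth k
  obtain ⟨B2, N2, hB2, hg2⟩ := Q.sol.growth k
  refine abs_le_of_parabolic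
    (w := fun t x => iteratedDeriv k (P.φ t) x - iteratedDeriv k (Q.φ t) x)
    (w1 := fun t x => iteratedDeriv (k + 1) (P.φ t) x - iteratedDeriv (k + 1) (Q.φ t) x)
    (w2 := fun t x => iteratedDeriv (k + 2) (P.φ t) x - iteratedDeriv (k + 2) (Q.φ t) x)
    (ρ := fun t => (C1 + C2) * (gap P Q + |P.m t - Q.m t|))
    (R := fun t => (C1 + C2) * (gap P Q * (T - t) + ∫ s in t..T, |P.m s - Q.m s|))
    (b := fun t x => 1 / 2 * P.m t * (deriv (P.φ t) x + deriv (Q.φ t) x))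
    (c := fun t x => 1 / 2 * P.m t * k * (iteratedDeriv 2 (P.φ t) x + iteratedDeriv 2 (Q.φ t) x))
    hT0 hT1 hβ le_rfl ((P.sol.cont k).sub (Q.sol.cont k)) ⟨B1 + B2, max N1 N2, fun t ht x => ?_⟩
    (fun t ht x => (P.hasDerivAt k (Set.Ico_subset_Icc_self ht) x).sub
      (Q.hasDerivAt k (Set.Ico_subset_Icc_self ht) x))
    (fun t ht x => (P.hasDerivAt (k + 1) (Set.Ico_subset_Icc_self ht) x).sub
      (Q.hasDerivAt (k + 1) (Set.Ico_subset_Icc_self ht) x))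
    (fun t ht x => (P.sol.evol k t ht x).sub (Q.sol.evol k t ht x))
    (fun t ht x => ?_) (fun t ht x => ?_) (fun t _ => by positivity) (fun t ht => ?_) ?_
    (fun t ht => ?_) (fun t ht x => ?_) (fun x => ?_) t htI x
  · have h1 := mul_le_mul_of_nonneg_left (weight_mono (le_max_left N1 N2) x) hB1
    have h2 := mul_le_mul_of_nonneg_left (weight_mono (le_max_right N1 N2) x) hB2
    have h3 := abs_sub (iteratedDeriv k (P.φ t) x) (iteratedDeriv k (Q.φ t) x)
    linarith [hg1 t ht x, hg2 t ht x]
  · have ht' := Set.Ico_subset_Icc_self ht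
    have h3 := abs_add_le (deriv (P.φ t) x) (deriv (Q.φ t) x)
    rw [abs_mul, abs_mul, abs_of_nonneg (P.m_nonneg t), abs_of_pos (by norm_num : (0 : ℝ) < 1 / 2)]
    have h4 := mul_le_of_le_one_left (abs_nonneg (deriv (P.φ t) x + deriv (Q.φ t) x)) (P.m_le_one t)
    linarith [hlin P t ht' x, hlin Q t ht' x]
  · have ht' := Set.Ico_subset_Icc_self ht
    have := P.m_nonneg t
    exact mul_nonpos_of_nonneg_of_nonpos (by positivity)
      (add_nonpos (P.iteratedDeriv_two_nonpos ht' x) (Q.iteratedDeriv_two_nonpos ht' x))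
  · have hI := P.integral_abs_sub_mem Q ht
    have h1 : 0 ≤ T - t := sub_nonneg.2 ht.2
    have h2 : gap P Q * (T - t) ≤ gap P Q := mul_le_of_le_one_right hPQ (by linarith [ht.1])
    refine ⟨mul_nonneg (by positivity) (add_nonneg (mul_nonneg hPQ h1) hI.1), ?_⟩
    exact mul_le_mul_of_nonneg_left (add_le_add h2 hI.2) (by positivity)
  · have : Continuous fun u => ∫ s in u..T, |P.m s - Q.m s| := by
      simp only [intervalIntegral.integral_symm T]
      exact (intervalIntegral.continuous_primitive (P.intervalIntegrable_abs_sub Q) T).neg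
    exact Continuous.continuousOn (by fun_prop)
  · have h1 : HasDerivWithinAt (fun t => gap P Q * (T - t)) (gap P Q * (-1)) (Set.Ici t) t :=
      (((hasDerivAt_id t).const_sub T).const_mul _).hasDerivWithinAt
    exact ((h1.add (P.hasDerivWithinAt_integral_abs_sub Q t)).const_mul (C1 + C2)).congr_deriv
      (by ring)
  · have ht' := Set.Ico_subset_Icc_self ht
    have h1 := (hrest ((P, Q), ⟨t, ht'⟩) x).trans (mul_le_mul_of_nonneg_left
      (weight_mono (le_max_left p1 p2) x) (mul_nonneg hC1 hPQ))
    have h2 := (hsq ((P, Q), ⟨t, ht'⟩) x).trans (mul_le_mul_of_nonneg_left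
      (weight_mono (le_max_right p1 p2) x) (by rwa [mul_one]))
    have h3 := iteratedDeriv_sq_sub_sq (P.contDiff_deriv ht') (Q.contDiff_deriv ht') k x
    simp only [mul_one] at h1 h2
    revert h3 h1
    generalize ∑ j ∈ Finset.range (k - 1), (k.choose (j + 2) : ℝ) *
        ((iteratedDeriv (j + 2) (deriv (P.φ t)) x + iteratedDeriv (j + 2) (deriv (Q.φ t)) x) *
          (iteratedDeriv (k - (j + 2)) (deriv (P.φ t)) x -
            iteratedDeriv (k - (j + 2)) (deriv (Q.φ t)) x)) = S
    intro h3 h1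
    have h4 : (k : ℝ) * (deriv (deriv (P.φ t)) x + deriv (deriv (Q.φ t)) x) *
        (iteratedDeriv (k - 1) (deriv (P.φ t)) x - iteratedDeriv (k - 1) (deriv (Q.φ t)) x) =
        k * (iteratedDeriv 2 (P.φ t) x + iteratedDeriv 2 (Q.φ t) x) *
          (iteratedDeriv k (P.φ t) x - iteratedDeriv k (Q.φ t) x) := by
      rcases k with _ | k
      · simp
      · simp only [iteratedDeriv_succ' (n := k), iteratedDeriv_succ (n := 1), iteratedDeriv_one,
          Nat.add_sub_cancel]
    rw [h4, ← iteratedDeriv_succ', ← iteratedDeriv_succ'] at h3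
    have hm := P.m_nonneg t
    have hm1 := P.m_le_one t
    revert h2 h3
    generalize iteratedDeriv k (fun y => deriv (Q.φ t) y * deriv (Q.φ t) y) x = V
    intro h2 h3
    have h5 := sub_eq_iff_eq_add.1 h3
    refine (le_of_eq (congrArg abs
      (?_ : _ = -(1 / 2 * (P.m t * S)) + -(1 / 2 * ((P.m t - Q.m t) * V))))).trans ?_
    · rw [h5]
      ring
    · refine (abs_add_le _ _).trans ?_
      rw [abs_neg, abs_neg, abs_mul, abs_mul, abs_mul, abs_mul, abs_of_nonneg hm,
        abs_of_pos (by norm_num : (0 : ℝ) < 1 / 2)]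
      have hW : (0 : ℝ) ≤ (1 + x ^ 2) ^ max p1 p2 := by positivity
      have h6 := mul_le_of_le_one_left (abs_nonneg S) hm1
      have h7 := mul_le_mul_of_nonneg_left h2 (abs_nonneg (P.m t - Q.m t))
      have h8 : 0 ≤ C1 * |P.m t - Q.m t| * (1 + x ^ 2) ^ max p1 p2 := by positivity
      have h9 : 0 ≤ C2 * gap P Q * (1 + x ^ 2) ^ max p1 p2 := by positivity
      nlinarith [abs_nonneg S, mul_nonneg (abs_nonneg (P.m t - Q.m t)) (abs_nonneg V)]
  · rw [P.terminal, Q.terminal]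
    simp

end ParisiFlow

namespace StepFn

/-- The Parisi solution of a step function as a flow with terminal time `qb`. -/
noncomputable def flow (γ : StepFn) (κ : ℝ) {qb : ℝ} (hq : γ.qbar ≤ qb) (hqb : qb < 1) :
    ParisiFlow (logTail κ √(1 - qb)) ((√(1 - qb))⁻¹ ^ 2) qb where
  φ := γ.Phi κ
  m := γ.level
  sol := (γ.parisiSol_Phi κ hq hqb).1
  concave := (γ.parisiSol_Phi κ hq hqb).2
  terminal := γ.Phi_terminal κ hq hqb
  m_nonneg := γ.level_nonneg
  m_le_one := γ.level_le_one
  m_mono := γ.level_mono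
  m_right := γ.continuousWithinAt_level

end StepFn

end Helpers

/-- Proposition 4.3 for step functions: for `γ₁, γ₂ ∈ SF⁺` with
`q̄ = max(q̄(γ₁), q̄(γ₂))`, every bounded `K ⊂ ℝ` and every `k ≥ 0`, there is a constant
`C > 0` depending only on `κ`, `q̄`, `K`, `k` (uniform over all pairs with the same `q̄`)
such that `sup_{t ∈ [0,q̄]} sup_{x ∈ K} |∂ₓᵏΦ_{γ₁}(t,x) − ∂ₓᵏΦ_{γ₂}(t,x)| ≤ C·‖γ₁ − γ₂‖_{L¹([0,1])}`. -/
theorem statement_5 (κ qb : ℝ) (γ : StepFn) (hγ : γ.qbar = qb)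
    (K : Set ℝ) (hK : Bornology.IsBounded K) (k : ℕ) :
    ∃ C > (0 : ℝ), ∀ γ₁ γ₂ : StepFn, max γ₁.qbar γ₂.qbar = qb →
      ∀ t ∈ Set.Icc (0 : ℝ) qb, ∀ x ∈ K,
        |iteratedDeriv k (fun y => γ₁.Phi κ t y) x -
            iteratedDeriv k (fun y => γ₂.Phi κ t y) x| ≤
          C * ∫ s in (0 : ℝ)..1, |γ₁.toFun s - γ₂.toFun s| := by
  have hqb : qb < 1 := hγ ▸ γ.qbar_lt_one
  have hq0 : 0 ≤ qb := hγ ▸ γ.qbar_nonneg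
  obtain ⟨C, p, hC, hb⟩ := ParisiFlow.scaledPolyB_sub (C := (√(1 - qb))⁻¹ ^ 2)
    (concaveData_logTail κ √(1 - qb)).temperate hq0 hqb.le (by positivity) k
  obtain ⟨M, hM⟩ := hK.exists_norm_le
  refine ⟨C * (1 + M ^ 2) ^ p + 1, by positivity, fun γ₁ γ₂ hmax t ht x hx => ?_⟩
  have h := hb ((γ₁.flow κ ((le_max_left _ _).trans hmax.le) hqb,
    γ₂.flow κ ((le_max_right _ _).trans hmax.le) hqb), ⟨t, ht⟩) x
  have hI := StepFn.integral_level_sub_le γ₁ γ₂ hq0 hqb.le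
  have hI0 : 0 ≤ ∫ s in (0 : ℝ)..1, |γ₁.toFun s - γ₂.toFun s| :=
    intervalIntegral.integral_nonneg zero_le_one fun _ _ => abs_nonneg _
  have hxM : (1 + x ^ 2) ^ p ≤ (1 + M ^ 2) ^ p := by
    have := sq_le_sq' (abs_le.1 (hM x hx)).1 (abs_le.1 (hM x hx)).2
    exact pow_le_pow_left₀ (by positivity) (by linarith) p
  refine h.trans ?_
  calc _ ≤ C * (∫ s in (0 : ℝ)..1, |γ₁.toFun s - γ₂.toFun s|) * (1 + M ^ 2) ^ p := by
        refine mul_le_mul (mul_le_mul_of_nonneg_left hI hC) hxM (by positivity) (by positivity)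
    _ ≤ _ := by linarith
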